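/- arXiv:math/0409069 — 4 statements merged into one kernel-verified Lean document; each statement's English description precedes it below -/
import Mathlib

section
/- If every set X ⊆ ℝ satisfying S1(Ω,Ω) is countable, then every strongly null set X ⊆ ℝ is countable. (Borel's Conjecture for S1(Ω,Ω) implies Borel's Conjecture.) -/
open Filter Set

/-- `f ≤* g`: `f n ≤ g n` for all but finitely many `n`. -/
def LeStar (f g : ℕ → ℕ) : Prop := ∀ᶠ n in Filter.atTop, f n ≤ g n

/-- A subset of Baire space is bounded if it has a `≤*`-upper bound. -/
def BddFam (B : Set (ℕ → ℕ)) : Prop := ∃ g : ℕ → ℕ, ∀ f ∈ B, LeStar f g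

/-- A subset of Baire space is dominating if every function is `≤*` below some member. -/
def DominatingFam (D : Set (ℕ → ℕ)) : Prop := ∀ g : ℕ → ℕ, ∃ f ∈ D, LeStar g f

/-- An open cover of a topological space. -/
def IsOpenCover {X : Type*} [TopologicalSpace X] (𝒰 : Set (Set X)) : Prop :=
  (∀ U ∈ 𝒰, IsOpen U) ∧ ⋃₀ 𝒰 = Set.univ

/-- The cover `𝒰` contains a finite subcover. -/
def HasFinSubcover {X : Type*} (𝒰 : Set (Set X)) : Prop :=
  ∃ ℱ ⊆ 𝒰, ℱ.Finite ∧ ⋃₀ ℱ = Set.univ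

/-- The Hurewicz property `Ufin(O,Γ)`. -/
def UfinOGamma (X : Type*) [TopologicalSpace X] : Prop :=
  ∀ 𝒰 : ℕ → Set (Set X),
    (∀ n, IsOpenCover (𝒰 n)) → (∀ n, ¬ HasFinSubcover (𝒰 n)) →
    ∃ ℱ : ℕ → Set (Set X),
      (∀ n, ℱ n ⊆ 𝒰 n ∧ (ℱ n).Finite) ∧
      ∀ x : X, ∀ᶠ n in Filter.atTop, x ∈ ⋃₀ ℱ n

/-- An `ω`-cover: no single member covers the whole space, but every finite set is
contained in some member. -/
def IsOmegaCover {X : Type*} (𝒰 : Set (Set X)) : Prop :=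
  ⋃₀ 𝒰 = Set.univ ∧ (∀ U ∈ 𝒰, U ≠ Set.univ) ∧
    ∀ F : Set X, F.Finite → ∃ U ∈ 𝒰, F ⊆ U

/-- A `γ`-cover: an infinite cover such that every point belongs to all but finitely many
members. -/
def IsGammaCover {X : Type*} (𝒰 : Set (Set X)) : Prop :=
  𝒰.Infinite ∧ ⋃₀ 𝒰 = Set.univ ∧ ∀ x : X, {U ∈ 𝒰 | x ∉ U}.Finite

/-- An open `ω`-cover. -/
def IsOpenOmegaCover {X : Type*} [TopologicalSpace X] (𝒰 : Set (Set X)) : Prop :=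
  (∀ U ∈ 𝒰, IsOpen U) ∧ IsOmegaCover 𝒰

/-- A set of reals is strongly null (has strong measure zero). -/
def StronglyNull (X : Set ℝ) : Prop :=
  ∀ ε : ℕ → ℝ, (∀ n, 0 < ε n) →
    ∃ I : ℕ → Set ℝ, (∀ n, EMetric.diam (I n) < ENNReal.ofReal (ε n)) ∧ X ⊆ ⋃ n, I n

/-- The Sakai property `S1(Ω,Ω)`. -/
def S1OmegaOmega (X : Type*) [TopologicalSpace X] : Prop :=
  ∀ 𝒰 : ℕ → Set (Set X), (∀ n, IsOpenOmegaCover (𝒰 n)) →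
    ∃ U : ℕ → Set X, (∀ n, U n ∈ 𝒰 n) ∧ IsOmegaCover (Set.range U)

/-- The conditions in `S1OmegaOmega` that are automatic can be omitted. -/
theorem s1OmegaOmega_of_forall_finite {X : Type*} [TopologicalSpace X]
    (hX : ∀ 𝒰 : ℕ → Set (Set X), (∀ n, IsOpenOmegaCover (𝒰 n)) →
      ∃ U : ℕ → Set X, (∀ n, U n ∈ 𝒰 n) ∧ ∀ F : Set X, F.Finite → ∃ n, F ⊆ U n) :
    S1OmegaOmega X := by
  intro 𝒰 h𝒰
  obtain ⟨U, hU, hF⟩ := hX 𝒰 h𝒰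
  refine ⟨U, hU, ?_, ?_, ?_⟩
  · refine eq_univ_of_forall fun x => ?_
    obtain ⟨n, hn⟩ := hF {x} (finite_singleton x)
    exact ⟨U n, mem_range_self n, hn rfl⟩
  · rintro _ ⟨n, rfl⟩
    exact (h𝒰 n).2.2.1 _ (hU n)
  · intro F hFin
    obtain ⟨n, hn⟩ := hF F hFin
    exact ⟨U n, mem_range_self n, hn⟩

/-- `S1(Ω,Ω)` is preserved by continuous surjections. -/
theorem S1OmegaOmega.of_surjective {X Y : Type*} [TopologicalSpace X] [TopologicalSpace Y]
    (hX : S1OmegaOmega X) {f : X → Y} (hf : Continuous f) (hs : Function.Surjective f) :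
    S1OmegaOmega Y := by
  apply s1OmegaOmega_of_forall_finite
  intro 𝒰 h𝒰
  obtain ⟨U, hU, -, -, hF⟩ := hX (fun n => preimage f '' 𝒰 n) fun n => by
    obtain ⟨ho, hc, hne, hfin⟩ := h𝒰 n
    refine ⟨?_, ?_, ?_, ?_⟩
    · rintro _ ⟨V, hV, rfl⟩
      exact (ho V hV).preimage hf
    · refine eq_univ_of_forall fun x => ?_
      obtain ⟨V, hV, hx⟩ := hc.ge (mem_univ (f x))
      exact ⟨_, mem_image_of_mem _ hV, hx⟩
    · rintro _ ⟨V, hV, rfl⟩ h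
      refine hne V hV (hs.preimage_injective (by rw [h, preimage_univ]))
    · intro F hF
      obtain ⟨V, hV, hFV⟩ := hfin (f '' F) (hF.image f)
      exact ⟨_, mem_image_of_mem _ hV, image_subset_iff.1 hFV⟩
  choose V hV hVU using hU
  refine ⟨V, hV, fun F hFin => ?_⟩
  obtain ⟨_, ⟨n, rfl⟩, hn⟩ := hF (Function.surjInv hs '' F) (hFin.image _)
  refine ⟨n, fun y hy => ?_⟩
  have := hn (mem_image_of_mem _ hy)
  rw [← hVU n, mem_preimage, Function.surjInv_eq hs] at this
  exact this

section Bounded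

/-- Countably many functions are bounded by a strictly monotone function. -/
theorem exists_strictMono_leStar {s : Set (ℕ → ℕ)} (hs : s.Countable) :
    ∃ g : ℕ → ℕ, StrictMono g ∧ ∀ f ∈ s, LeStar f g := by
  obtain rfl | hne := s.eq_empty_or_nonempty
  · exact ⟨id, strictMono_id, by simp⟩
  obtain ⟨e, rfl⟩ := hs.exists_eq_range hne
  let g : ℕ → ℕ := fun n => Nat.rec 0
    (fun n r => r + 1 + ∑ k ∈ Finset.range (n + 1), e k (n + 1)) n
  refine ⟨g, strictMono_nat_of_lt_succ fun n => ?_, ?_⟩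
  · change g n < g n + 1 + _
    omega
  · rintro _ ⟨k, rfl⟩
    filter_upwards [eventually_gt_atTop k] with n hn
    obtain ⟨n, rfl⟩ := Nat.exists_eq_add_one_of_ne_zero (by omega : n ≠ 0)
    change _ ≤ g n + 1 + _
    have := Finset.single_le_sum (f := fun k => e k (n + 1)) (fun _ _ => Nat.zero_le _)
      (Finset.mem_range.2 hn)
    omega

theorem LeStar.trans {f g h : ℕ → ℕ} (hfg : LeStar f g) (hgh : LeStar g h) : LeStar f h := by
  filter_upwards [hfg, hgh] with n h₁ h₂ using h₁.trans h₂

/-- A family indexed by a well-order with countable initial segments is dominated termwise by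
a `≤*`-increasing family of strictly monotone functions. -/
theorem exists_leStar_increasing {ι : Type*} [LinearOrder ι] [WellFoundedLT ι]
    (hι : ∀ i : ι, (Iio i).Countable) (h : ι → ℕ → ℕ) :
    ∃ f : ι → ℕ → ℕ, (∀ i, StrictMono (f i)) ∧ (∀ i, LeStar (h i) (f i)) ∧
      ∀ i j, i ≤ j → LeStar (f i) (f j) := by
  choose! G hG hGs using fun s : Set (ℕ → ℕ) => exists_strictMono_leStar (s := s)
  let F : ∀ i : ι, (∀ j, j < i → ℕ → ℕ) → ℕ → ℕ :=
    fun i ih => G (insert (h i) (range fun j : Iio i => ih j j.2))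
  let f : ι → ℕ → ℕ := wellFounded_lt.fix F
  have hf : ∀ i, f i = G (insert (h i) (range fun j : Iio i => f j)) :=
    fun i => wellFounded_lt.fix_eq F i
  have hc : ∀ i, (insert (h i) (range fun j : Iio i => f j)).Countable := fun i => by
    have := (hι i).to_subtype
    exact (countable_range _).insert _
  refine ⟨f, fun i => ?_, fun i => ?_, fun i j hij => ?_⟩
  · rw [hf]
    exact hG _ (hc i)
  · rw [hf]
    exact hGs _ (hc i) _ (mem_insert _ _)
  · obtain rfl | hlt := hij.eq_or_lt
    · exact Eventually.of_forall fun n => le_rfl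
    · rw [hf j]
      exact hGs _ (hc j) _ (mem_insert_of_mem _ ⟨⟨i, hlt⟩, rfl⟩)

end Bounded

section Concentrated

/-- The points of Cantor space vanishing from `m` on. -/
def vanishingFrom (m : ℕ) : Set (ℕ → Bool) := {p | ∀ j, m ≤ j → p j = false}

theorem finite_vanishingFrom (m : ℕ) : (vanishingFrom m).Finite := by
  refine Finite.of_injOn (f := fun (p : ℕ → Bool) (i : Fin m) => p i)
    (mapsTo_univ _ _) ?_ finite_univ
  intro p hp q hq hpq
  funext j
  by_cases hj : j < m
  · exact congrFun hpq ⟨j, hj⟩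
  · rw [hp j (not_lt.1 hj), hq j (not_lt.1 hj)]

variable {X : Set (ℕ → Bool)}

/-- Galvin and Miller: an open set containing the points vanishing from `m` on contains all points
vanishing on a sufficiently long interval starting at `m`. -/
theorem exists_forall_vanishing_mem (hX : ∀ m, vanishingFrom m ⊆ X) {U : Set X} (hU : IsOpen U)
    {m : ℕ} (hm : Subtype.val ⁻¹' vanishingFrom m ⊆ U) :
    ∃ m', m < m' ∧ ∀ p : X, (∀ j, m ≤ j → j < m' → p.1 j = false) → p ∈ U := by
  obtain ⟨V, hV, rfl⟩ := isOpen_induced_iff.1 hU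
  have hcyl : ∀ q ∈ vanishingFrom m, ∃ n, PiNat.cylinder q n ⊆ V := by
    intro q hq
    have hqV : q ∈ V := hm (show (⟨q, hX m hq⟩ : X).1 ∈ vanishingFrom m from hq)
    obtain ⟨_, ⟨x, n, rfl⟩, hqx, hxV⟩ :=
      (PiNat.isTopologicalBasis_cylinders (fun _ : ℕ => Bool)).exists_subset_of_mem_open hqV hV
    rw [← PiNat.mem_cylinder_iff_eq.1 hqx] at hxV
    exact ⟨n, hxV⟩
  choose! N hN using hcyl
  obtain ⟨B, hB⟩ := ((finite_vanishingFrom m).image N).bddAbove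
  refine ⟨max (m + 1) B, by omega, fun p hp => ?_⟩
  let q : ℕ → Bool := fun j => if j < m then p.1 j else false
  have hq : q ∈ vanishingFrom m := fun j hj => if_neg (not_lt.2 hj)
  have hqB : N q ≤ B := hB (mem_image_of_mem _ hq)
  refine hN q hq (PiNat.mem_cylinder_iff.2 fun j hj => ?_)
  by_cases hjm : j < m
  · exact (if_pos hjm).symm
  · rw [hp j (not_lt.1 hjm) (by omega)]
    exact (if_neg hjm).symm

theorem exists_selection (hX : ∀ m, vanishingFrom m ⊆ X) {𝒰 : ℕ → Set (Set X)}
    (h𝒰 : ∀ n, IsOpenOmegaCover (𝒰 n)) {A : ℕ → Set X} (hA : ∀ n, (A n).Finite) :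
    ∃ (U : ℕ → Set X) (m : ℕ → ℕ), (∀ n, U n ∈ 𝒰 n) ∧ (∀ n, A n ⊆ U n) ∧ StrictMono m ∧
      ∀ n, ∀ p : X, (∀ j, m n ≤ j → j < m (n + 1) → p.1 j = false) → p ∈ U n := by
  have step : ∀ n m, ∃ (U : Set X) (m' : ℕ), U ∈ 𝒰 n ∧ A n ⊆ U ∧ m < m' ∧
      ∀ p : X, (∀ j, m ≤ j → j < m' → p.1 j = false) → p ∈ U := by
    intro n m
    obtain ⟨U, hU, hsub⟩ := (h𝒰 n).2.2.2 (A n ∪ Subtype.val ⁻¹' vanishingFrom m)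
      ((hA n).union ((finite_vanishingFrom m).preimage Subtype.val_injective.injOn))
    obtain ⟨m', hlt, hm'⟩ := exists_forall_vanishing_mem hX ((h𝒰 n).1 U hU)
      (subset_union_right.trans hsub)
    exact ⟨U, m', hU, subset_union_left.trans hsub, hlt, hm'⟩
  choose U m' hU hAU hlt hm' using step
  let m : ℕ → ℕ := fun n => Nat.rec 0 m' n
  exact ⟨fun n => U n (m n), m, fun n => hU _ _, fun n => hAU _ _,
    strictMono_nat_of_lt_succ fun n => hlt _ _, fun n => hm' _ _⟩

open Classical in
/-- The characteristic function of the range of a sequence of natural numbers. -/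
noncomputable def rangeChar (f : ℕ → ℕ) : ℕ → Bool := fun j => decide (j ∈ range f)

theorem rangeChar_eq_false {f : ℕ → ℕ} {j : ℕ} : rangeChar f j = false ↔ ∀ i, f i ≠ j := by
  simp [rangeChar]

theorem rangeChar_injOn : InjOn rangeChar {f | StrictMono f} := by
  intro f hf g hg hfg
  refine (StrictMono.range_inj hf hg).1 (ext fun j => ?_)
  simpa [rangeChar] using congrFun hfg j

/-- At most `#S` sequences whose `n`-th term is large have ranges simultaneously missing some
interval of a given partition. -/
theorem exists_common_gap {ι : Type*} {f : ι → ℕ → ℕ} (hf : ∀ i, StrictMono (f i)) {m : ℕ → ℕ}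
    (hm : StrictMono m) {S : Finset ι} {n : ℕ} (hS : S.card ≤ n)
    (hn : ∀ i ∈ S, m (n + (n * n + 1)) < f i n) :
    ∃ k, n ≤ k ∧ ∀ i ∈ S, ∀ j, m k ≤ j → j < m (k + 1) → rangeChar (f i) j = false := by
  by_contra! hcon
  have hit : ∀ k, n ≤ k → ∃ q : ι × ℕ, q.1 ∈ S ∧ m k ≤ f q.1 q.2 ∧ f q.1 q.2 < m (k + 1) := by
    intro k hk
    obtain ⟨i, hi, j, h₁, h₂, h₃⟩ := hcon k hk
    have : ∃ l, f i l = j := by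
      by_contra! h
      exact h₃ (rangeChar_eq_false.2 h)
    obtain ⟨l, rfl⟩ := this
    exact ⟨(i, l), hi, h₁, h₂⟩
  have : Nonempty ι := let ⟨q, _⟩ := hit n le_rfl; ⟨q.1⟩
  choose! q hqS hq₁ hq₂ using hit
  obtain ⟨a, ha, b, hb, hab, heq⟩ := Finset.exists_ne_map_eq_of_card_lt_of_maps_to
    (s := Finset.Ico n (n + (n * n + 1))) (t := S ×ˢ Finset.range n) (f := q)
    (by
      rw [Finset.card_product, Finset.card_range, Nat.card_Ico]
      have := Nat.mul_le_mul_right n hS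
      omega)
    (by
      intro k hk
      have hk' := Finset.mem_Ico.1 (Finset.mem_coe.1 hk)
      refine Finset.mem_coe.2 (Finset.mem_product.2
        ⟨hqS k hk'.1, Finset.mem_range.2 ((hf (q k).1).lt_iff_lt.1 ?_)⟩)
      calc f (q k).1 (q k).2 < m (k + 1) := hq₂ k hk'.1
        _ ≤ m (n + (n * n + 1)) := hm.monotone (by omega)
        _ < f (q k).1 n := hn _ (hqS k hk'.1))
  have key : ∀ a b, n ≤ a → n ≤ b → q a = q b → a ≤ b := by
    intro a b ha hb heq
    have h₁ := hq₁ a ha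
    have h₂ := hq₂ b hb
    rw [heq] at h₁
    exact Nat.lt_succ_iff.1 (hm.lt_iff_lt.1 (h₁.trans_lt h₂))
  have ha' := (Finset.mem_Ico.1 ha).1
  have hb' := (Finset.mem_Ico.1 hb).1
  exact hab (le_antisymm (key a b ha' hb' heq) (key b a hb' ha' heq.symm))

/-- Cofinally in an unbounded `≤*`-increasing family, any finitely many members simultaneously miss
infinitely many intervals of a given partition. -/
theorem exists_forall_finset_common_gap {ι : Type*} [LinearOrder ι] {f : ι → ℕ → ℕ}
    (hf : ∀ i, StrictMono (f i)) (hle : ∀ i j, i ≤ j → LeStar (f i) (f j))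
    (hunb : ∀ g : ℕ → ℕ, ∃ i, ¬ LeStar (f i) g) {m : ℕ → ℕ} (hm : StrictMono m) :
    ∃ i₀, ∀ S : Finset ι, (∀ i ∈ S, i₀ ≤ i) → ∀ N, ∃ k, N ≤ k ∧
      ∀ i ∈ S, ∀ j, m k ≤ j → j < m (k + 1) → rangeChar (f i) j = false := by
  obtain ⟨i₀, hi₀⟩ := hunb fun n => m (n + (n * n + 1))
  refine ⟨i₀, fun S hS N => ?_⟩
  have hev : ∀ᶠ n in atTop, ∀ i ∈ S, f i₀ n ≤ f i n :=
    S.eventually_all.2 fun i hi => hle i₀ i (hS i hi)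
  obtain ⟨n, hn, hSn, hNn⟩ := ((not_eventually.1 hi₀).and_eventually
    (hev.and (eventually_ge_atTop (max N S.card)))).exists
  obtain ⟨k, hk, hgap⟩ := exists_common_gap hf hm (S := S) (n := n) (by omega)
    fun i hi => (not_le.1 hn).trans_le (hSn i hi)
  exact ⟨k, by omega, hgap⟩

/-- The set associated with an unbounded `≤*`-increasing family of strictly monotone functions
indexed by a well-order with countable initial segments satisfies `S1(Ω,Ω)`. -/
theorem s1OmegaOmega_rangeChar {ι : Type*} [LinearOrder ι]
    (hι : ∀ i : ι, (Iio i).Countable) {f : ι → ℕ → ℕ}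
    (hf : ∀ i, StrictMono (f i)) (hle : ∀ i j, i ≤ j → LeStar (f i) (f j))
    (hunb : ∀ g : ℕ → ℕ, ∃ i, ¬ LeStar (f i) g) :
    S1OmegaOmega ↥((⋃ m, vanishingFrom m) ∪ range fun i => rangeChar (f i)) := by
  set X := (⋃ m, vanishingFrom m) ∪ range fun i => rangeChar (f i) with hXdef
  have hX : ∀ m, vanishingFrom m ⊆ X := fun m =>
    (subset_iUnion _ m).trans subset_union_left
  let x : ι → X := fun i => ⟨rangeChar (f i), Or.inr (mem_range_self i)⟩
  apply s1OmegaOmega_of_forall_finite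
  intro 𝒰 h𝒰
  have step : ∀ r (b : ι), ∃ b' : ι, b ≤ b' ∧ ∃ U : ℕ → Set X,
      (∀ n, U n ∈ 𝒰 (Nat.pair r n)) ∧ ∀ S : Finset ι, (∀ i ∈ S, i < b ∨ b' ≤ i) →
        ∀ M, ∃ n, x '' S ⊆ U n ∧ Subtype.val ⁻¹' vanishingFrom M ⊆ U n := by
    intro r b
    obtain ⟨e, he⟩ := ((hι b).insert b).exists_eq_range (insert_nonempty _ _)
    obtain ⟨U, m, hU, hAU, hm, hmU⟩ := exists_selection hX
      (fun n => h𝒰 (Nat.pair r n)) (A := fun n => (fun k => x (e k)) '' Iio n)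
      fun n => (finite_Iio n).image _
    obtain ⟨i₀, hi₀⟩ := exists_forall_finset_common_gap hf hle hunb hm
    refine ⟨max b i₀, le_max_left _ _, U, hU, fun S hS M => ?_⟩
    have hsmall : ∀ i, i < b → ∃ k, e k = i := fun i hi =>
      he.le (mem_insert_of_mem _ hi)
    choose! κ hκ using hsmall
    obtain ⟨B, hB⟩ := (S.finite_toSet.image κ).bddAbove
    obtain ⟨n, hn, hgap⟩ := hi₀ (S.filter (i₀ ≤ ·)) (by simp) (max M (B + 1))
    refine ⟨n, ?_, ?_⟩
    · rintro _ ⟨i, hi, rfl⟩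
      obtain hib | hib := hS i hi
      · have hBi := hB (mem_image_of_mem κ hi)
        exact hAU n ⟨κ i, show κ i < n by omega, congrArg x (hκ i hib)⟩
      · exact hmU n (x i) (hgap i (Finset.mem_filter.2 ⟨hi, (le_max_right _ _).trans hib⟩))
    · intro p hp
      exact hmU n p fun j hj _ => hp j (by have := hm.id_le n; simp only [id] at this; omega)
  choose b' hb' U hU hcov using step
  obtain ⟨i₁, -⟩ := hunb 0
  let b : ℕ → ι := fun r => Nat.rec i₁ b' r
  have hb : Monotone b := monotone_nat_of_le_succ fun r => hb' r (b r)
  refine ⟨fun n => U n.unpair.1 (b n.unpair.1) n.unpair.2, fun n => ?_, fun F hF => ?_⟩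
  · simpa using hU n.unpair.1 (b n.unpair.1) n.unpair.2
  have hdec : ∃ (S : Finset ι) (M : ℕ), F ⊆ x '' S ∪ Subtype.val ⁻¹' vanishingFrom M := by
    induction F, hF using Set.Finite.induction_on with
    | empty => exact ⟨∅, 0, empty_subset _⟩
    | @insert p F _ _ ih =>
      obtain ⟨S, M, hSM⟩ := ih
      classical
      obtain ⟨p, hp | ⟨i, rfl⟩⟩ := p
      · obtain ⟨M', hM'⟩ := mem_iUnion.1 hp
        refine ⟨S, max M M', insert_subset (Or.inr fun j hj => hM' j (by omega)) ?_⟩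
        exact hSM.trans (union_subset_union_right _ fun q hq j hj => hq j (by omega))
      · refine ⟨insert i S, M, insert_subset (Or.inl ⟨i, by simp, rfl⟩) ?_⟩
        exact hSM.trans (union_subset_union_left _ (image_mono (by simp)))
  obtain ⟨S, M, hSM⟩ := hdec
  have hr : ∀ᶠ r in atTop, ∀ i ∈ S, i < b r ∨ b (r + 1) ≤ i := by
    rw [Finset.eventually_all]
    intro i _
    obtain ⟨r, hr⟩ | h := Classical.em (∃ r, i < b r)
    · filter_upwards [eventually_ge_atTop r] with r' hr' using Or.inl (hr.trans_le (hb hr'))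
    · push Not at h
      exact Eventually.of_forall fun r => Or.inr (h (r + 1))
  obtain ⟨r, hr⟩ := hr.exists
  obtain ⟨n, hn₁, hn₂⟩ := hcov r (b r) S hr M
  exact ⟨Nat.pair r n, by simpa using hSM.trans (union_subset hn₁ hn₂)⟩

/-- If some family of functions indexed by an uncountable well-order with countable initial segments
is unbounded, there is an uncountable set of reals satisfying `S1(Ω,Ω)`. -/
theorem exists_uncountable_s1OmegaOmega {ι : Type*} [LinearOrder ι] [WellFoundedLT ι]
    (hι : ∀ i : ι, (Iio i).Countable) {h : ι → ℕ → ℕ} (hunb : ¬ BddFam (range h)) :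
    ∃ X : Set ℝ, S1OmegaOmega X ∧ ¬ X.Countable := by
  obtain ⟨f, hf, hhf, hle⟩ := exists_leStar_increasing hι h
  have hunb' : ∀ g : ℕ → ℕ, ∃ i, ¬ LeStar (f i) g := by
    intro g
    by_contra! hg
    exact hunb ⟨g, forall_mem_range.2 fun i => (hhf i).trans (hg i)⟩
  let e : (ℕ → Bool) → ℝ := fun p => (cantorSetHomeomorphNatToBool.symm p : ℝ)
  have he : Continuous e :=
    continuous_subtype_val.comp cantorSetHomeomorphNatToBool.symm.continuous
  have hinj : Function.Injective e :=
    Subtype.val_injective.comp cantorSetHomeomorphNatToBool.symm.injective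
  refine ⟨e '' ((⋃ m, vanishingFrom m) ∪ range fun i => rangeChar (f i)), ?_, fun hc => ?_⟩
  · exact (s1OmegaOmega_rangeChar hι hf hle hunb').of_surjective
      (f := fun p => ⟨e p, mem_image_of_mem e p.2⟩)
      ((he.comp continuous_subtype_val).subtype_mk _)
      (by rintro ⟨_, p, hp, rfl⟩; exact ⟨⟨p, hp⟩, rfl⟩)
  · have hc' := (countable_of_injective_of_countable_image hinj.injOn hc).mono
      subset_union_right
    have hc'' : (range f).Countable := by
      refine countable_of_injective_of_countable_image
        (f := rangeChar) (rangeChar_injOn.mono (range_subset_iff.2 hf)) ?_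
      rwa [← range_comp]
    obtain ⟨g, -, hg⟩ := exists_strictMono_leStar hc''
    obtain ⟨i, hi⟩ := hunb' g
    exact hi (hg _ (mem_range_self i))

end Concentrated

section SmallStronglyNull

variable {X : Set ℝ}

theorem StronglyNull.mono {Y : Set ℝ} (hX : StronglyNull X) (hYX : Y ⊆ X) : StronglyNull Y := by
  intro ε hε
  obtain ⟨I, hI, hcov⟩ := hX ε hε
  exact ⟨I, hI, hYX.trans hcov⟩

theorem StronglyNull.exists_cover (hX : StronglyNull X) {ε : ℕ → ℝ} (hε : ∀ n, 0 < ε n) :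
    ∃ J : ℕ → Set X, (∀ n, ∀ x ∈ J n, ∀ y ∈ J n, dist x y < ε n) ∧ ∀ x, ∃ n, x ∈ J n := by
  obtain ⟨I, hI, hcov⟩ := hX ε hε
  refine ⟨fun n => Subtype.val ⁻¹' I n, fun n x hx y hy => ?_, fun x => ?_⟩
  · have := (Metric.edist_le_ediam_of_mem (s := I n) hx hy).trans_lt (hI n)
    rw [edist_dist, ENNReal.ofReal_lt_ofReal_iff (hε n)] at this
    exact this
  · simpa using hcov x.2

/-- Finite powers of a strongly null set on which all families of functions are bounded are strongly
null, with each point covered infinitely often. -/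
theorem StronglyNull.exists_pow_cover (hX : StronglyNull X)
    (hbdd : ∀ h : X → ℕ → ℕ, BddFam (range h)) (k : ℕ) {ε : ℕ → ℝ} (hε : ∀ n, 0 < ε n) :
    ∃ I : ℕ → Set (Fin k → X), (∀ n, ∀ v ∈ I n, ∀ w ∈ I n, ∀ i, dist (v i) (w i) < ε n) ∧
      ∀ v, ∃ᶠ n in atTop, v ∈ I n := by
  induction k generalizing ε with
  | zero =>
    exact ⟨fun _ => univ, fun _ _ _ _ _ i => i.elim0,
      fun v => Frequently.of_forall fun _ => mem_univ v⟩
  | succ k ih =>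
    choose J hJ hcov using fun m => hX.exists_cover fun j => hε (Nat.pair m j)
    choose h hh using fun x m => hcov m x
    obtain ⟨g, hg⟩ := hbdd h
    obtain ⟨I, hI, hIcov⟩ := ih (ε := fun m => (Finset.range (g m + 1)).inf'
      Finset.nonempty_range_add_one fun j => ε (Nat.pair m j))
      fun m => (Finset.lt_inf'_iff _).2 fun j _ => hε _
    refine ⟨fun n => {v | n.unpair.2 ≤ g n.unpair.1 ∧ v 0 ∈ J n.unpair.1 n.unpair.2 ∧
      Fin.tail v ∈ I n.unpair.1}, ?_, ?_⟩
    · rintro n v ⟨hn, hv₀, hv⟩ w ⟨-, hw₀, hw⟩ i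
      refine Fin.cases ?_ (fun i => ?_) i
      · simpa using hJ _ _ _ hv₀ _ hw₀
      · have := (Finset.lt_inf'_iff _).1 (hI _ _ hv _ hw i) n.unpair.2
          (Finset.mem_range.2 (by omega))
        simpa [Fin.tail] using this
    · intro v
      rw [frequently_atTop]
      intro N
      obtain ⟨m, hm, hgm, hNm⟩ := ((hIcov (Fin.tail v)).and_eventually
        ((hg _ (mem_range_self (v 0))).and (eventually_ge_atTop N))).exists
      exact ⟨Nat.pair m (h (v 0) m), hNm.trans (Nat.left_le_pair _ _), by simpa using hgm,
        by simpa using hh (v 0) m, by simpa using hm⟩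

/-- A strongly null set on whose finite subsets all families of functions are bounded satisfies
`S1(Ω,Ω)`. -/
theorem StronglyNull.s1OmegaOmega (hX : StronglyNull X)
    (hbdd : ∀ h : X → ℕ → ℕ, BddFam (range h))
    (hbdd' : ∀ h : Finset X → ℕ → ℕ, BddFam (range h)) : S1OmegaOmega X := by
  apply s1OmegaOmega_of_forall_finite
  intro 𝒰 h𝒰
  have hnhd : ∀ (F : Finset X) n, ∃ m : ℕ, ∃ U ∈ 𝒰 n, ∀ x ∈ F, ∀ y, dist x y < 1 / ((m : ℝ) + 1) →
      y ∈ U := by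
    intro F n
    obtain ⟨U, hU, hFU⟩ := (h𝒰 n).2.2.2 F F.finite_toSet
    obtain ⟨δ, hδ, hsub⟩ := F.finite_toSet.isCompact.exists_thickening_subset_open
      ((h𝒰 n).1 U hU) hFU
    obtain ⟨m, hm⟩ := exists_nat_one_div_lt hδ
    refine ⟨m, U, hU, fun x hx y hxy => hsub (Metric.mem_thickening_iff.2 ⟨x, hx, ?_⟩)⟩
    rw [dist_comm]
    exact hxy.trans hm
  choose h hh using hnhd
  obtain ⟨g, hg⟩ := hbdd' h
  choose I hI hcov using fun k => hX.exists_pow_cover hbdd k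
    (ε := fun j => 1 / ((g (Nat.pair k j) : ℝ) + 1)) fun j => by positivity
  let B : ℕ → ℕ → Set X := fun k j => ⋃ v ∈ I k j, range v
  have hsel : ∀ n, ∃ U ∈ 𝒰 n, (∃ V ∈ 𝒰 n, B n.unpair.1 n.unpair.2 ⊆ V) →
      B n.unpair.1 n.unpair.2 ⊆ U := by
    intro n
    by_cases hB : ∃ V ∈ 𝒰 n, B n.unpair.1 n.unpair.2 ⊆ V
    · obtain ⟨V, hV, hBV⟩ := hB
      exact ⟨V, hV, fun _ => hBV⟩
    · obtain ⟨U, hU, -⟩ := (h𝒰 n).2.2.2 ∅ finite_empty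
      exact ⟨U, hU, fun h => absurd h hB⟩
  choose U hU hBU using hsel
  refine ⟨U, hU, fun F hF => ?_⟩
  lift F to Finset X using hF
  let v : Fin F.card → X := fun i => F.equivFin.symm i
  obtain ⟨N, hN⟩ := eventually_atTop.1 (hg _ (mem_range_self F))
  obtain ⟨j, hj, hNj⟩ := ((hcov F.card v).and_eventually (eventually_ge_atTop N)).exists
  have hgj := hN _ (hNj.trans (Nat.right_le_pair F.card j))
  have hBU' := hBU (Nat.pair F.card j)
  rw [Nat.unpair_pair] at hBU'
  refine ⟨Nat.pair F.card j, fun x hx => hBU' ?_ ?_⟩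
  · obtain ⟨V, hV, hFV⟩ := hh F (Nat.pair F.card j)
    refine ⟨V, hV, iUnion₂_subset fun w hw => range_subset_iff.2 fun i => ?_⟩
    refine hFV (v i) (F.equivFin.symm i).2 _ ((hI _ _ v hj w hw i).trans_le ?_)
    gcongr
  · exact mem_iUnion₂.2 ⟨v, hj, F.equivFin ⟨x, hx⟩, by simp [v]⟩

end SmallStronglyNull

open Cardinal in
/-- Weiss et al.: Borel's Conjecture for `S1(Ω,Ω)` implies Borel's Conjecture. -/
theorem BC_for_s1OmegaOmega_implies_BC
    (h : ∀ X : Set ℝ, S1OmegaOmega X → X.Countable) :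
    ∀ X : Set ℝ, StronglyNull X → X.Countable := by
  intro X hX
  by_contra hXc
  obtain ⟨Y, hYX, hY⟩ := le_mk_iff_exists_subset.1
    (Cardinal.aleph_one_le_iff.2 (not_le.1 (mt le_aleph0_iff_set_countable.1 hXc)))
  obtain ⟨ι, hι⟩ : ∃ ι : Type, #ι = ℵ₁ := ⟨Y, hY⟩
  obtain ⟨_, _, hord⟩ := exists_ord_eq_type_lt ι
  by_cases hb : ∀ f : ι → ℕ → ℕ, BddFam (range f)
  · have hbdd : ∀ Z : Type, #Z = ℵ₁ → ∀ f : Z → ℕ → ℕ, BddFam (range f) := by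
      intro Z hZ f
      obtain ⟨e⟩ := Cardinal.eq.1 (hι.trans hZ.symm)
      rw [← e.surjective.range_comp f]
      exact hb _
    have : Infinite Y := infinite_iff.2 (by rw [hY]; exact aleph0_le_aleph 1)
    have hYc := h Y ((hX.mono hYX).s1OmegaOmega (hbdd _ hY)
      (hbdd _ ((mk_finset_of_infinite Y).trans hY)))
    rw [← le_aleph0_iff_set_countable, hY] at hYc
    exact hYc.not_gt aleph0_lt_aleph_one
  · push Not at hb
    obtain ⟨f, hf⟩ := hb
    obtain ⟨Z, hZ, hZc⟩ := exists_uncountable_s1OmegaOmega (fun i : ι =>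
      le_aleph0_iff_set_countable.1 (lt_aleph_one_iff.1 (hι ▸ mk_Iio_lt i hord))) hf
    exact hZc (h Z hZ)
end

section
/- Assume cov(M) = 𝔠 (in particular this follows from the Continuum Hypothesis). Then there exist sets L0, L1 ⊆ ℕ^ℕ, each satisfying S1(B_Ω,B_Ω), such that L0 ∪ L1 is finitely dominating. -/
open Filter Set

/-- A subset of the Baire space is finitely dominating if every `g` is eventually bounded
by the pointwise maximum of finitely many of its members. -/
def FinitelyDominating (Y : Set (ℕ → ℕ)) : Prop :=
  ∀ g : ℕ → ℕ, ∃ F : Set (ℕ → ℕ), F ⊆ Y ∧ F.Finite ∧ F.Nonempty ∧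
    ∀ᶠ n in Filter.atTop, ∃ f ∈ F, g n ≤ f n

/-- `cov(M)`: the minimal cardinality of a family of meager sets of reals covering `ℝ`. -/
noncomputable def covM : Cardinal :=
  sInf { c : Cardinal | ∃ 𝓜 : Set (Set ℝ), (∀ M ∈ 𝓜, IsMeagre M) ∧
    ⋃₀ 𝓜 = Set.univ ∧ Cardinal.mk 𝓜 = c }

/-- A Borel subset of a topological space. -/
def IsBorel {X : Type*} [TopologicalSpace X] (U : Set X) : Prop :=
  @MeasurableSet X (borel X) U

/-- A countable Borel `ω`-cover. -/
def CtblBorelOmegaCover {X : Type*} [TopologicalSpace X] (𝒰 : Set (Set X)) : Prop :=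
  𝒰.Countable ∧ (∀ U ∈ 𝒰, IsBorel U) ∧ IsOmegaCover 𝒰

/-- The property `S1(B_Ω,B_Ω)`. -/
def S1BOmegaBOmega (X : Type*) [TopologicalSpace X] : Prop :=
  ∀ 𝒰 : ℕ → Set (Set X), (∀ n, CtblBorelOmegaCover (𝒰 n)) →
    ∃ U : ℕ → Set X, (∀ n, U n ∈ 𝒰 n) ∧ CtblBorelOmegaCover (Set.range U)

/-- The `n`-th coordinate of `binaryRows r` is the position of the first zero in the `n`-th row of
the binary digits of `r`, arranged in a two-dimensional array along `Nat.pair`. -/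
noncomputable def binaryRows (r : ℝ) (n : ℕ) : ℕ :=
  sInf {k | Even ⌊(2 : ℝ) ^ Nat.pair n k * r⌋}

lemma floor_two_pow_mul (p q : ℕ) (r : ℝ) :
    ⌊(2 : ℝ) ^ p * r⌋ = ⌊(2 : ℝ) ^ (p + q) * r⌋ / 2 ^ q := by
  have h := Int.floor_div_natCast ((2 : ℝ) ^ (p + q) * r) (2 ^ q)
  push_cast at h
  rw [← h]
  congr 1
  rw [pow_add]
  field_simp

lemma exists_floor_of_digits (m : ℕ) (a : ℤ) (e : ℕ → Prop) (P : ℕ) :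
    ∃ b : ℤ, ∀ r : ℝ, ⌊(2 : ℝ) ^ (m + P) * r⌋ = b → ⌊(2 : ℝ) ^ m * r⌋ = a ∧
      ∀ p, m < p → p ≤ m + P → (Even ⌊(2 : ℝ) ^ p * r⌋ ↔ e p) := by
  classical
  induction P with
  | zero => exact ⟨a, fun r hr => ⟨hr, fun p h1 h2 => by omega⟩⟩
  | succ P ih =>
    obtain ⟨b, hb⟩ := ih
    refine ⟨2 * b + if e (m + (P + 1)) then 0 else 1, fun r hr => ?_⟩
    have h1 : ⌊(2 : ℝ) ^ (m + P) * r⌋ = b := by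
      rw [floor_two_pow_mul (m + P) 1, add_assoc, hr]
      split_ifs <;> omega
    obtain ⟨h2, h3⟩ := hb r h1
    refine ⟨h2, fun p hp hp' => ?_⟩
    rcases hp'.lt_or_eq with h | rfl
    · exact h3 p hp (by omega)
    · rw [hr]
      split_ifs with he <;> simp [he]

lemma exists_open_subset_binaryRows_mem {J : Set ℝ} (hJ : IsOpen J) (hJne : J.Nonempty)
    {U : Set (ℕ → ℕ)} (hU : IsOpen U) (hUd : Dense U) :
    ∃ J' ⊆ J, IsOpen J' ∧ J'.Nonempty ∧ ∀ r ∈ J', binaryRows r ∈ U := by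
  classical
  obtain ⟨x, hx⟩ := hJne
  obtain ⟨ε, hε, hball⟩ := Metric.isOpen_iff.1 hJ x hx
  obtain ⟨m, hm⟩ := exists_pow_lt_of_lt_one hε (one_half_lt_one (α := ℝ))
  set s : ℕ → ℕ := fun n => sInf {k | m < Nat.pair n k ∨ Even ⌊(2 : ℝ) ^ Nat.pair n k * x⌋}
    with hs
  obtain ⟨y, hyU, hys⟩ := hUd.exists_mem_open (PiNat.isOpen_cylinder (fun _ => ℕ) s (m + 1))
    ⟨s, PiNat.self_mem_cylinder s _⟩
  obtain ⟨_, ⟨y', L, rfl⟩, hy', hL⟩ :=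
    (PiNat.isTopologicalBasis_cylinders (fun _ => ℕ)).exists_subset_of_mem_open hyU hU
  rw [← PiNat.mem_cylinder_iff_eq.1 hy'] at hL
  set e : ℕ → Prop := fun p => p.unpair.1 ≤ m ∨ y p.unpair.1 ≤ p.unpair.2 with he
  set P : ℕ := ∑ n ∈ Finset.range L, Nat.pair n (y n) with hP
  obtain ⟨b, hb⟩ := exists_floor_of_digits m ⌊(2 : ℝ) ^ m * x⌋ e P
  have hpow : (0 : ℝ) < 2 ^ (m + P) := by positivity
  refine ⟨{r | (b : ℝ) < 2 ^ (m + P) * r ∧ 2 ^ (m + P) * r < b + 1}, ?_, ?_, ?_, ?_⟩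
  · rintro r ⟨h1, h2⟩
    obtain ⟨h3, -⟩ := hb r (Int.floor_eq_iff.2 ⟨h1.le, h2⟩)
    refine hball ?_
    have h4 := Int.abs_sub_lt_one_of_floor_eq_floor h3
    rw [← mul_sub, abs_mul, abs_of_pos (by positivity : (0 : ℝ) < 2 ^ m)] at h4
    rw [Metric.mem_ball, Real.dist_eq]
    refine lt_trans ?_ hm
    refine lt_of_mul_lt_mul_left (a := (2 : ℝ) ^ m) ?_ (by positivity)
    rwa [← mul_pow, mul_one_div_cancel two_ne_zero, one_pow]
  · exact (isOpen_lt continuous_const (continuous_const_mul _)).inter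
      (isOpen_lt (continuous_const_mul _) continuous_const)
  · refine ⟨(b + 1 / 2) / 2 ^ (m + P), ?_⟩
    simp only [Set.mem_ofPred_eq]
    rw [mul_div_cancel₀ _ hpow.ne']
    constructor <;> linarith
  · rintro r ⟨h1, h2⟩
    obtain ⟨h3, h4⟩ := hb r (Int.floor_eq_iff.2 ⟨h1.le, h2⟩)
    refine hL (PiNat.mem_cylinder_iff.2 fun n hn => ?_)
    have hle : ∀ k ≤ y n, Nat.pair n k ≤ m + P := fun k hk => by
      have h5 : Nat.pair n k ≤ Nat.pair n (y n) := by
        rcases hk.lt_or_eq with h | rfl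
        · exact (Nat.pair_lt_pair_right n h).le
        · exact le_rfl
      have h6 : Nat.pair n (y n) ≤ P :=
        Finset.single_le_sum (f := fun n => Nat.pair n (y n)) (fun _ _ => Nat.zero_le _)
          (Finset.mem_range.2 hn)
      omega
    have hlow : ∀ p ≤ m, ⌊(2 : ℝ) ^ p * r⌋ = ⌊(2 : ℝ) ^ p * x⌋ := fun p hp => by
      rw [floor_two_pow_mul p (m - p) r, floor_two_pow_mul p (m - p) x, Nat.add_sub_cancel' hp, h3]
    have key : Even ⌊(2 : ℝ) ^ Nat.pair n (y n) * r⌋ ∧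
        ∀ k < y n, ¬ Even ⌊(2 : ℝ) ^ Nat.pair n k * r⌋ := by
      rcases le_or_gt n m with hnm | hnm
      · have hE : ∀ k ≤ y n, (Even ⌊(2 : ℝ) ^ Nat.pair n k * r⌋ ↔
            m < Nat.pair n k ∨ Even ⌊(2 : ℝ) ^ Nat.pair n k * x⌋) := fun k hk => by
          rcases le_or_gt (Nat.pair n k) m with h | h
          · simp [hlow _ h, h.not_gt]
          · rw [h4 _ h (hle k hk)]
            simp [he, h, hnm]
        have hyn : y n = s n := PiNat.mem_cylinder_iff.1 hys n (by omega)
        have hne : {k | m < Nat.pair n k ∨ Even ⌊(2 : ℝ) ^ Nat.pair n k * x⌋}.Nonempty :=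
          ⟨m + 1, Or.inl (Nat.right_le_pair n (m + 1))⟩
        refine ⟨(hE _ le_rfl).2 ?_, fun k hk => (hE k hk.le).not.2 ?_⟩
        · rw [hyn]
          exact Nat.sInf_mem hne
        · rw [hyn] at hk
          exact Nat.notMem_of_lt_sInf hk
      · have hE : ∀ k ≤ y n, (Even ⌊(2 : ℝ) ^ Nat.pair n k * r⌋ ↔ y n ≤ k) := fun k hk => by
          rw [h4 _ (hnm.trans_le (Nat.left_le_pair n k)) (hle k hk)]
          simp [he, hnm.not_ge]
        exact ⟨(hE _ le_rfl).2 le_rfl, fun k hk => (hE k hk.le).not.2 (by omega)⟩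
    refine le_antisymm (Nat.sInf_le key.1) (not_lt.1 fun h => ?_)
    have hmem := Nat.sInf_mem (s := {k | Even ⌊(2 : ℝ) ^ Nat.pair n k * r⌋}) ⟨y n, key.1⟩
    exact key.2 _ h hmem

lemma tendsto_binaryRows_residual :
    Filter.Tendsto binaryRows (residual ℝ) (residual (ℕ → ℕ)) := by
  apply Filter.le_countableGenerate_iff_of_countableInterFilter.mpr
  rintro U ⟨hU, hUd⟩
  refine Filter.mem_of_superset (x := interior (binaryRows ⁻¹' U))
    (residual_of_dense_open isOpen_interior ?_) interior_subset
  refine dense_iff_inter_open.2 fun J hJ hJne => ?_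
  obtain ⟨J', hJ'J, hJ', ⟨r, hr⟩, h⟩ := exists_open_subset_binaryRows_mem hJ hJne hU hUd
  exact ⟨r, hJ'J hr, interior_maximal h hJ' hr⟩

/-- If `cov(M) = 𝔠`, then fewer than continuum many meager sets do not cover the Baire space. -/
lemma exists_notMem_of_isMeagre (h : covM = Cardinal.continuum) {𝓜 : Set (Set (ℕ → ℕ))}
    (h𝓜 : Cardinal.mk 𝓜 < Cardinal.continuum) (hM : ∀ M ∈ 𝓜, IsMeagre M) :
    ∃ z : ℕ → ℕ, ∀ M ∈ 𝓜, z ∉ M := by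
  by_contra! hcon
  refine h𝓜.not_ge ?_
  rw [← h]
  refine (csInf_le' ⟨(binaryRows ⁻¹' ·) '' 𝓜, ?_, ?_, rfl⟩ :
    covM ≤ Cardinal.mk ((binaryRows ⁻¹' ·) '' 𝓜)).trans Cardinal.mk_image_le
  · rintro _ ⟨M, hM', rfl⟩
    exact tendsto_binaryRows_residual (hM M hM')
  · refine Set.eq_univ_of_forall fun r => ?_
    obtain ⟨M, hM', hr⟩ := hcon (binaryRows r)
    exact ⟨_, ⟨M, hM', rfl⟩, hr⟩

/-- `U` contains `P` and is nonmeager in every member of the finite family `𝓞` of basic open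
sets. -/
def IsThickOver (P : Set (ℕ → ℕ)) (𝓞 : Finset (TopologicalSpace.countableBasis (ℕ → ℕ)))
    (U : Set (ℕ → ℕ)) : Prop :=
  P ⊆ U ∧ ∀ O ∈ 𝓞, ¬ IsMeagre (U ∩ O.1)

/-- For each finite family of basic open sets, some `v n` is thick over `P`. An `ω`-fat cover is
one that is fat over each finite set of points. -/
def IsFatOver (P : Set (ℕ → ℕ)) (v : ℕ → Set (ℕ → ℕ)) : Prop :=
  ∀ 𝓞, ∃ n, IsThickOver P 𝓞 (v n)

lemma IsFatOver.isMeagre_notMem {P : Set (ℕ → ℕ)} {v : ℕ → Set (ℕ → ℕ)} (hv : IsFatOver P v)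
    (hm : ∀ n, MeasurableSet (v n)) (𝓞 : Finset (TopologicalSpace.countableBasis (ℕ → ℕ))) :
    IsMeagre {x | ∀ n, IsThickOver P 𝓞 (v n) → x ∉ v n} := by
  classical
  set W : Set (ℕ → ℕ) := ⋃ n ∈ {n | IsThickOver P 𝓞 (v n)}, v n with hW
  have hWm : MeasurableSet W := MeasurableSet.biUnion (Set.to_countable _) fun n _ => hm n
  have hWc : {x | ∀ n, IsThickOver P 𝓞 (v n) → x ∉ v n} = Wᶜ := by
    ext x
    simp [hW]
  rw [hWc, IsMeagre, compl_compl]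
  obtain ⟨u, hu, hWu⟩ := hWm.residualEq_isOpen
  have hud : Dense u := by
    by_contra hud
    obtain ⟨y, hy⟩ : ∃ y, y ∉ closure u := by simpa [Dense] using hud
    obtain ⟨O, hO, -, hOu⟩ :=
      (TopologicalSpace.isBasis_countableBasis (ℕ → ℕ)).exists_subset_of_mem_open
        (a := y) (u := (closure u)ᶜ) hy isClosed_closure.isOpen_compl
    obtain ⟨n, hn⟩ := hv (insert ⟨O, hO⟩ 𝓞)
    refine hn.2 ⟨O, hO⟩ (Finset.mem_insert_self _ _) ?_
    have hn' : IsThickOver P 𝓞 (v n) := ⟨hn.1, fun O' hO' => hn.2 O' (Finset.mem_insert_of_mem hO')⟩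
    filter_upwards [hWu] with x hx hxv
    have hxW : x ∈ W := Set.mem_biUnion (s := {n | IsThickOver P 𝓞 (v n)}) hn' hxv.1
    have hxu : x ∈ u := (Eq.to_iff hx).1 hxW
    exact hOu hxv.2 (subset_closure hxu)
  filter_upwards [hWu, residual_of_dense_open hu hud] with x hx hxu
  exact (Eq.to_iff hx).2 hxu

lemma isMeagre_setOf_forall_not_isThickOver {P : Set (ℕ → ℕ)} {u : ℕ → ℕ → Set (ℕ → ℕ)}
    {𝓞 : Finset (TopologicalSpace.countableBasis (ℕ → ℕ))}
    (hu : ∀ n, ∃ m, IsThickOver P 𝓞 (u n m)) :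
    IsMeagre {w : ℕ → ℕ | ∀ n, ¬ IsThickOver P 𝓞 (u n (w n))} := by
  have hc : {w : ℕ → ℕ | ∀ n, ¬ IsThickOver P 𝓞 (u n (w n))}ᶜ =
      ⋃ n, (fun w : ℕ → ℕ => w n) ⁻¹' {m | IsThickOver P 𝓞 (u n m)} := by
    ext w
    simp
  rw [IsMeagre, hc]
  refine residual_of_dense_open
    (isOpen_iUnion fun n => (isOpen_discrete _).preimage (continuous_apply n)) ?_
  refine dense_iff_inter_open.2 fun J hJ ⟨w, hw⟩ => ?_
  obtain ⟨_, ⟨w', k, rfl⟩, hw', hJ'⟩ :=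
    (PiNat.isTopologicalBasis_cylinders (fun _ => ℕ)).exists_subset_of_mem_open hw hJ
  rw [← PiNat.mem_cylinder_iff_eq.1 hw'] at hJ'
  obtain ⟨m, hm⟩ := hu k
  refine ⟨Function.update w k m, hJ' (PiNat.update_mem_cylinder w k m), ?_⟩
  exact Set.mem_iUnion.2 ⟨k, by simpa using hm⟩

open Cardinal in
/-- Transfinite choice of points of the Baire space, each avoiding fewer than continuum many meager
sets that depend on finitely many earlier choices. -/
lemma exists_seq_notMem_of_isMeagre (h : covM = 𝔠) {T C : Type} [Countable C] (hT : #T ≤ 𝔠)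
    (N : T → (T → ℕ → ℕ) → Finset T → C → Set (ℕ → ℕ))
    (hN : ∀ t z z' F c, (∀ s ∈ F, z s = z' s) → N t z F c = N t z' F c)
    (hmeagre : ∀ t z F c, IsMeagre (N t z F c)) :
    ∃ (st : T → (𝔠 : Cardinal.{0}).ord.ToType) (z : T → ℕ → ℕ), Function.Injective st ∧
      ∀ t F c, (∀ s ∈ F, st s < st t) → z t ∉ N t z F c := by
  classical
  obtain ⟨e⟩ : Nonempty (T ↪ (𝔠 : Cardinal.{0}).ord.ToType) := by
    rwa [← Cardinal.le_def, Cardinal.mk_ord_toType]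
  have step : ∀ t (z : T → ℕ → ℕ),
      ∃ x, ∀ F c, (∀ s ∈ F, e s < e t) → x ∉ N t z F c := by
    intro t z
    set S := {s // e s < e t}
    have hS : #S < 𝔠 := by
      have h1 : #S ≤ #(Set.Iio (e t)) :=
        Cardinal.mk_le_of_injective (f := fun s : S => (⟨e s.1, s.2⟩ : Set.Iio (e t)))
          fun a b hab => Subtype.ext (e.injective (congrArg Subtype.val hab))
      refine h1.trans_lt ?_
      simpa using Cardinal.mk_Iio_lt (e t)
    have hFS : #(Finset S) < 𝔠 := by
      rcases finite_or_infinite S with hf | hi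
      · exact (Cardinal.mk_lt_aleph0).trans Cardinal.aleph0_lt_continuum
      · rwa [Cardinal.mk_finset_of_infinite]
    have hcard : #(Finset S × C) < 𝔠 := by
      rw [Cardinal.mk_prod, Cardinal.lift_id, Cardinal.lift_id]
      exact Cardinal.mul_lt_of_lt Cardinal.aleph0_le_continuum hFS
        (Cardinal.mk_le_aleph0.trans_lt Cardinal.aleph0_lt_continuum)
    obtain ⟨x, hx⟩ := exists_notMem_of_isMeagre h
      (𝓜 := Set.range fun p : Finset S × C =>
        N t z (p.1.map (Function.Embedding.subtype _)) p.2)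
      (Cardinal.mk_range_le.trans_lt hcard)
      (by rintro _ ⟨p, rfl⟩; exact hmeagre _ _ _ _)
    refine ⟨x, fun F c hF => ?_⟩
    have hxF := hx _ ⟨(F.subtype (fun s => e s < e t), c), rfl⟩
    dsimp only at hxF
    rwa [Finset.subtype_map_of_mem hF] at hxF
  choose f hf using step
  have wf : WellFounded fun s t : T => e s < e t := InvImage.wf e wellFounded_lt
  set z : T → ℕ → ℕ :=
    wf.fix fun t ih => f t fun s => if hs : e s < e t then ih s hs else 0 with hz
  have hzt : ∀ t, z t = f t fun s => if e s < e t then z s else 0 := fun t => by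
    rw [hz, wf.fix_eq]
    congr
  refine ⟨e, z, e.injective, fun t F c hF => ?_⟩
  have h1 := hf t (fun s => if e s < e t then z s else 0) F c hF
  rw [← hzt] at h1
  rwa [hN t z _ F c fun s hs => (if_pos (hF s hs)).symm]

/-- A point of the cylinder of `s` of length `k` read off from `z`. Beyond `k`, it is at least `g`
at each place where the parity of `z` is `i`. -/
def parityPoint (i : Bool) (g s : ℕ → ℕ) (k : ℕ) (z : ℕ → ℕ) : ℕ → ℕ :=
  Pi.map (fun n m => if n < k then s n else m / 2 + if (m % 2 == 0) = i then g n else 0) z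

lemma parityPoint_mem_cylinder (i : Bool) (g s : ℕ → ℕ) (k : ℕ) (z : ℕ → ℕ) :
    parityPoint i g s k z ∈ PiNat.cylinder s k :=
  PiNat.mem_cylinder_iff.2 fun n hn => by simp [parityPoint, hn]

lemma exists_le_parityPoint_zero (g s z : ℕ → ℕ) (n : ℕ) :
    ∃ i, g n ≤ parityPoint i g s 0 z n :=
  ⟨z n % 2 == 0, by simp [parityPoint]⟩

lemma IsMeagre.preimage_parityPoint (i : Bool) (g s : ℕ → ℕ) (k : ℕ) {M : Set (ℕ → ℕ)}
    (hM : IsMeagre M) : IsMeagre (parityPoint i g s k ⁻¹' M) := by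
  refine hM.preimage_of_isOpenMap
    (Continuous.piMap fun n => continuous_of_discreteTopology)
    (IsOpenMap.piMap (fun n => fun _ _ => isOpen_discrete _) ?_)
  rw [Nat.cofinite_eq_atTop]
  filter_upwards [Filter.eventually_ge_atTop k] with n hn y
  refine ⟨2 * y + if i then 1 else 0, ?_⟩
  cases i
  · simp [hn.not_gt]
  · simp [hn.not_gt]
    omega

open Cardinal in
lemma mk_measurableSet_baire_le : #{s : Set (ℕ → ℕ) // MeasurableSet s} ≤ 𝔠 := by
  have hb := (TopologicalSpace.isBasis_countableBasis (ℕ → ℕ)).borel_eq_generateFrom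
  have := MeasurableSpace.cardinal_measurableSet_le_continuum
    (s := TopologicalSpace.countableBasis (ℕ → ℕ))
    ((TopologicalSpace.countable_countableBasis (ℕ → ℕ)).le_aleph0.trans aleph0_le_continuum)
  rw [← hb, ← BorelSpace.measurable_eq (α := ℕ → ℕ)] at this
  exact this

/-- Borel subsets of the Baire space. -/
abbrev BaireBorelSet : Type := {s : Set (ℕ → ℕ) // MeasurableSet s}

/-- The requests for a new point: it should help to dominate a given function, lie in a given
cylinder, and avoid a given Borel set if the latter is meager. -/
abbrev PointRequest : Type := (ℕ → ℕ) × (ℕ → ℕ) × ℕ × BaireBorelSet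

/-- The sequences of enumerated families of Borel sets, each of which requests a selector. -/
abbrev SelectorRequest : Type := ℕ → ℕ → BaireBorelSet

open Cardinal in
lemma mk_request_le : #(PointRequest ⊕ SelectorRequest) ≤ 𝔠 := by
  have hB : #BaireBorelSet ≤ 𝔠 := mk_measurableSet_baire_le
  have hS : #SelectorRequest ≤ 𝔠 := by
    have h1 : #(ℕ → BaireBorelSet) ≤ 𝔠 := by
      rw [← Cardinal.power_def, ← continuum_power_aleph0, mk_nat]
      exact Cardinal.power_le_power_right hB
    change #(ℕ → ℕ → BaireBorelSet) ≤ 𝔠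
    rw [← Cardinal.power_def, ← continuum_power_aleph0, mk_nat]
    exact Cardinal.power_le_power_right h1
  have hP : #PointRequest ≤ 𝔠 := by
    have h1 : #(ℕ → ℕ) = 𝔠 := by
      rw [← Cardinal.power_def, mk_nat, aleph0_power_aleph0]
    simp only [PointRequest, mk_prod, lift_id, h1, mk_nat]
    exact mul_le_of_le aleph0_le_continuum le_rfl (mul_le_of_le aleph0_le_continuum le_rfl
      (mul_le_of_le aleph0_le_continuum aleph0_le_continuum hB))
  rw [mk_sum, lift_id, lift_id]
  exact add_le_of_le aleph0_le_continuum hP hS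

/-- The point of the `i`-th set requested by `a` and read off from `w`. -/
def PointRequest.point (i : Bool) (a : PointRequest) (w : ℕ → ℕ) : ℕ → ℕ :=
  parityPoint i a.1 a.2.1 a.2.2.1 w

/-- The set to be avoided at a request, given some earlier choices. -/
def avoidSet (t : PointRequest ⊕ SelectorRequest)
    (z : PointRequest ⊕ SelectorRequest → ℕ → ℕ) (F : Finset (PointRequest ⊕ SelectorRequest))
    (c : Bool × Finset (TopologicalSpace.countableBasis (ℕ → ℕ))) : Set (ℕ → ℕ) :=
  let P : Set (ℕ → ℕ) := {x | ∃ a, Sum.inl a ∈ F ∧ x = PointRequest.point c.1 a (z (Sum.inl a))}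
  match t with
  | Sum.inl a => PointRequest.point c.1 a ⁻¹' ({x | IsMeagre a.2.2.2.1 ∧ x ∈ a.2.2.2.1} ∪
      ⋃ b : {b : SelectorRequest // Sum.inr b ∈ F},
        {x | IsFatOver P (fun n => (b.1 n (z (Sum.inr b.1) n)).1) ∧
          ∀ n, IsThickOver P c.2 (b.1 n (z (Sum.inr b.1) n)).1 →
            x ∉ (b.1 n (z (Sum.inr b.1) n)).1})
  | Sum.inr b => {w | (∀ n, ∃ m, IsThickOver P c.2 (b n m).1) ∧
      ∀ n, ¬ IsThickOver P c.2 (b n (w n)).1}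

lemma avoidSet_congr (t : PointRequest ⊕ SelectorRequest)
    (z z' : PointRequest ⊕ SelectorRequest → ℕ → ℕ) (F : Finset (PointRequest ⊕ SelectorRequest))
    (c : Bool × Finset (TopologicalSpace.countableBasis (ℕ → ℕ))) (h : ∀ s ∈ F, z s = z' s) :
    avoidSet t z F c = avoidSet t z' F c := by
  have hP : {x | ∃ a, Sum.inl a ∈ F ∧ x = PointRequest.point c.1 a (z (Sum.inl a))} =
      {x | ∃ a, Sum.inl a ∈ F ∧ x = PointRequest.point c.1 a (z' (Sum.inl a))} := by
    ext x
    exact exists_congr fun a => and_congr_right fun ha => by rw [h _ ha]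
  have hb : ∀ b : {b : SelectorRequest // Sum.inr b ∈ F}, z (Sum.inr b.1) = z' (Sum.inr b.1) :=
    fun b => h _ b.2
  cases t <;> simp only [avoidSet, hP, hb]

lemma isMeagre_avoidSet (t : PointRequest ⊕ SelectorRequest)
    (z : PointRequest ⊕ SelectorRequest → ℕ → ℕ) (F : Finset (PointRequest ⊕ SelectorRequest))
    (c : Bool × Finset (TopologicalSpace.countableBasis (ℕ → ℕ))) :
    IsMeagre (avoidSet t z F c) := by
  cases t with
  | inl a =>
    refine IsMeagre.preimage_parityPoint _ _ _ _ (IsMeagre.union ?_ ?_)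
    · by_cases hM : IsMeagre a.2.2.2.1
      · exact hM.mono fun x hx => hx.2
      · exact IsMeagre.empty.mono fun x hx => hM hx.1
    · have : Finite {b : SelectorRequest // Sum.inr b ∈ F} :=
        Finite.of_injective (fun b => (⟨Sum.inr b.1, b.2⟩ : F)) fun b b' hbb' => by
          simpa [Subtype.ext_iff] using hbb'
      refine isMeagre_iUnion fun b => ?_
      by_cases hf : IsFatOver {x | ∃ a, Sum.inl a ∈ F ∧ x = PointRequest.point c.1 a (z (Sum.inl a))}
          (fun n => (b.1 n (z (Sum.inr b.1) n)).1)
      · exact (hf.isMeagre_notMem (fun n => (b.1 n _).2) c.2).mono fun x hx => hx.2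
      · exact IsMeagre.empty.mono fun x hx => hf hx.1
  | inr b =>
    by_cases hf : ∀ n, ∃ m, IsThickOver
        {x | ∃ a, Sum.inl a ∈ F ∧ x = PointRequest.point c.1 a (z (Sum.inl a))} c.2 (b n m).1
    · exact (isMeagre_setOf_forall_not_isThickOver hf).mono fun w hw => hw.2
    · exact IsMeagre.empty.mono fun w hw => hf hw.1

/-- The points chosen for the requests in `F`. -/
def chosenPoints (i : Bool) (z : PointRequest ⊕ SelectorRequest → ℕ → ℕ)
    (F : Finset PointRequest) : Set (ℕ → ℕ) :=
  (fun a => PointRequest.point i a (z (Sum.inl a))) '' F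

/-- The choices can be made so that each point avoids the requested meager set, and each sequence
of fat families has a fat selection. -/
lemma exists_choices (h : covM = Cardinal.continuum) :
    ∃ z : PointRequest ⊕ SelectorRequest → ℕ → ℕ,
      (∀ i (a : PointRequest), IsMeagre a.2.2.2.1 →
        PointRequest.point i a (z (Sum.inl a)) ∉ a.2.2.2.1) ∧
      ∀ i (b : SelectorRequest),
        (∀ n F, IsFatOver (chosenPoints i z F) (fun m => (b n m).1)) →
        ∀ F, IsFatOver (chosenPoints i z F) (fun n => (b n (z (Sum.inr b) n)).1) := by
  classical
  obtain ⟨st, z, hst, hz⟩ := exists_seq_notMem_of_isMeagre h mk_request_le avoidSet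
    avoidSet_congr isMeagre_avoidSet
  have hP : ∀ i (F : Finset PointRequest) (G : Finset SelectorRequest),
      {x | ∃ a, Sum.inl a ∈ F.disjSum G ∧ x = PointRequest.point i a (z (Sum.inl a))} =
        chosenPoints i z F := by
    intro i F G
    ext x
    simp [chosenPoints, eq_comm]
  refine ⟨z, fun i a hM hmem => ?_, fun i b hb F => ?_⟩
  · exact hz (Sum.inl a) ∅ (i, ∅) (by simp) (Or.inl ⟨hM, hmem⟩)
  · induction F using Finset.induction_on_max_value (fun a : PointRequest => st (Sum.inl a)) with
    | empty =>
      intro 𝓞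
      have h1 := hz (Sum.inr b) ((∅ : Finset PointRequest).disjSum ∅) (i, 𝓞) (by simp)
      simp only [avoidSet, hP] at h1
      by_contra! h2
      exact h1 ⟨fun n => hb n ∅ 𝓞, h2⟩
    | insert a s has hmax ih =>
      intro 𝓞
      have hlt : ∀ x ∈ s, st (Sum.inl x) < st (Sum.inl a) := fun x hx =>
        (hmax x hx).lt_of_ne fun heq => has (Sum.inl_injective (hst heq) ▸ hx)
      rcases lt_trichotomy (st (Sum.inl a)) (st (Sum.inr b)) with hab | hab | hab
      · have h1 := hz (Sum.inr b) ((insert a s).disjSum ∅) (i, 𝓞) fun t ht => by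
          rcases Finset.mem_disjSum.1 ht with ⟨x, hx, rfl⟩ | ⟨x, hx, rfl⟩
          · rcases Finset.mem_insert.1 hx with rfl | hx
            · exact hab
            · exact (hlt x hx).trans hab
          · exact absurd hx (Finset.notMem_empty x)
        simp only [avoidSet, hP] at h1
        by_contra! h2
        exact h1 ⟨fun n => hb n _ 𝓞, h2⟩
      · exact absurd (hst hab) (by simp)
      · have h1 := hz (Sum.inl a) (s.disjSum {b}) (i, 𝓞) fun t ht => by
          rcases Finset.mem_disjSum.1 ht with ⟨x, hx, rfl⟩ | ⟨x, hx, rfl⟩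
          · exact hlt x hx
          · rwa [Finset.mem_singleton.1 hx]
        simp only [avoidSet, hP] at h1
        by_contra! h2
        refine h1 (Or.inr (Set.mem_iUnion.2 ⟨⟨b, by simp⟩, ih, fun n hn hmem => h2 n ⟨?_, hn.2⟩⟩))
        rw [chosenPoints, Finset.coe_insert, Set.image_insert_eq]
        exact Set.insert_subset hmem hn.1

/-- The set of all points of index `i`. -/
def pointSet (i : Bool) (z : PointRequest ⊕ SelectorRequest → ℕ → ℕ) : Set (ℕ → ℕ) :=
  Set.range fun a => PointRequest.point i a (z (Sum.inl a))

/-- An `ω`-cover of an everywhere nonmeager set by Borel sets is fat over its finite subsets. -/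
lemma isFatOver_of_forall_finite {L : Set (ℕ → ℕ)}
    (hL : ∀ (O M : Set (ℕ → ℕ)), IsOpen O → O.Nonempty → MeasurableSet M → IsMeagre M →
      ∃ x ∈ L, x ∈ O ∧ x ∉ M)
    {v : ℕ → Set (ℕ → ℕ)} (hm : ∀ n, MeasurableSet (v n))
    (hv : ∀ P ⊆ L, P.Finite → ∃ n, P ⊆ v n) {P : Set (ℕ → ℕ)} (hP : P ⊆ L) (hPf : P.Finite) :
    IsFatOver P v := by
  classical
  intro 𝓞
  have hex : ∀ O : TopologicalSpace.countableBasis (ℕ → ℕ), ∃ x ∈ L, x ∈ O.1 ∧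
      x ∉ ⋃ n ∈ {n | IsMeagre (v n ∩ O.1)}, v n ∩ O.1 := fun O => by
    have hO := TopologicalSpace.isOpen_of_mem_countableBasis O.2
    exact hL O.1 _ hO (TopologicalSpace.nonempty_of_mem_countableBasis O.2)
      (MeasurableSet.biUnion (Set.to_countable _) fun n _ => (hm n).inter hO.measurableSet)
      (isMeagre_biUnion (Set.to_countable _) fun n hn => hn)
  choose y hyL hyO hyM using hex
  obtain ⟨n, hn⟩ := hv (P ∪ y '' 𝓞) (Set.union_subset hP (by rintro _ ⟨O, -, rfl⟩; exact hyL O))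
    (hPf.union (𝓞.finite_toSet.image y))
  refine ⟨n, Set.subset_union_left.trans hn, fun O hO hmeagre => hyM O ?_⟩
  exact Set.mem_biUnion (s := {n | IsMeagre (v n ∩ O.1)}) hmeagre
    ⟨hn (Or.inr ⟨O, hO, rfl⟩), hyO O⟩

lemma CtblBorelOmegaCover.exists_eq_range {L : Set (ℕ → ℕ)} {𝒰 : Set (Set L)}
    (h : CtblBorelOmegaCover 𝒰) :
    ∃ v : ℕ → BaireBorelSet, 𝒰 = Set.range fun n => (Subtype.val ⁻¹' (v n).1 : Set L) := by
  obtain ⟨hc, hB, -, -, hω⟩ := h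
  obtain ⟨U₀, hU₀, -⟩ := hω ∅ Set.finite_empty
  obtain ⟨u, rfl⟩ := hc.exists_eq_range ⟨U₀, hU₀⟩
  have hv : ∀ n, ∃ v : BaireBorelSet, (Subtype.val ⁻¹' v.1 : Set L) = u n := fun n => by
    have h1 : @MeasurableSet L (borel L) (u n) := hB _ ⟨n, rfl⟩
    have h2 : borel L = (borel (ℕ → ℕ)).comap Subtype.val := borel_comap
    rw [h2, ← BorelSpace.measurable_eq (α := ℕ → ℕ)] at h1
    obtain ⟨s, hs, hsu⟩ := h1
    exact ⟨⟨s, hs⟩, hsu⟩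
  choose v hv using hv
  exact ⟨v, by simp only [hv]⟩

/-- Bartoszyński–Shelah et al.: assuming `cov(M) = 𝔠`, there are two subsets of the Baire
space satisfying `S1(B_Ω,B_Ω)` whose union is finitely dominating. -/
theorem s1BOmega_not_additive (h : covM = Cardinal.continuum) :
    ∃ L0 L1 : Set (ℕ → ℕ), S1BOmegaBOmega L0 ∧ S1BOmegaBOmega L1 ∧
      FinitelyDominating (L0 ∪ L1) := by
  classical
  obtain ⟨z, hz, hsel⟩ := exists_choices h
  have hnm : ∀ i (O M : Set (ℕ → ℕ)), IsOpen O → O.Nonempty → MeasurableSet M → IsMeagre M →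
      ∃ x ∈ pointSet i z, x ∈ O ∧ x ∉ M := by
    intro i O M hO ⟨x, hx⟩ hM hMm
    obtain ⟨_, ⟨s, k, rfl⟩, -, hs⟩ :=
      (PiNat.isTopologicalBasis_cylinders (fun _ => ℕ)).exists_subset_of_mem_open hx hO
    exact ⟨_, ⟨(0, s, k, ⟨M, hM⟩), rfl⟩, hs (parityPoint_mem_cylinder _ _ _ _ _),
      hz i (0, s, k, ⟨M, hM⟩) hMm⟩
  have hS : ∀ i, S1BOmegaBOmega (pointSet i z) := by
    intro i 𝒰 h𝒰
    choose b hb using fun n => (h𝒰 n).exists_eq_range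
    have hF : ∀ F, chosenPoints i z F ⊆ pointSet i z := fun F => Set.image_subset_range _ _
    have hfat := hsel i b fun n F => by
      refine isFatOver_of_forall_finite (hnm i) (fun m => (b n m).2) (fun P hP hPf => ?_) (hF F)
        (F.finite_toSet.image _)
      obtain ⟨U, hU, hPU⟩ := (h𝒰 n).2.2.2.2 (Subtype.val ⁻¹' P)
        (hPf.preimage Subtype.val_injective.injOn)
      rw [hb n] at hU
      obtain ⟨m, rfl⟩ := hU
      exact ⟨m, fun x hx => hPU (a := ⟨x, hP hx⟩) hx⟩
    have hmem : ∀ n, (Subtype.val ⁻¹' (b n (z (Sum.inr b) n)).1 : Set (pointSet i z)) ∈ 𝒰 n :=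
      fun n => (hb n).symm ▸ ⟨_, rfl⟩
    have hω : ∀ G : Set (pointSet i z), G.Finite → ∃ U ∈ Set.range fun n =>
        (Subtype.val ⁻¹' (b n (z (Sum.inr b) n)).1 : Set (pointSet i z)), G ⊆ U := by
      intro G hG
      choose a ha using fun x : pointSet i z => x.2
      obtain ⟨n, hn, -⟩ := hfat (hG.toFinset.image a) ∅
      refine ⟨_, ⟨n, rfl⟩, fun x hx => hn ⟨a x, ?_, ha x⟩⟩
      exact Finset.mem_coe.2 (Finset.mem_image_of_mem a (hG.mem_toFinset.2 hx))
    refine ⟨_, hmem, Set.countable_range _, ?_, ?_, ?_, hω⟩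
    · rintro _ ⟨n, rfl⟩
      exact (h𝒰 n).2.1 _ (hmem n)
    · refine Set.eq_univ_of_forall fun x => ?_
      obtain ⟨U, hU, hx⟩ := hω {x} (Set.finite_singleton x)
      exact ⟨U, hU, hx rfl⟩
    · rintro _ ⟨n, rfl⟩
      exact (h𝒰 n).2.2.2.1 _ (hmem n)
  refine ⟨pointSet false z, pointSet true z, hS false, hS true, fun g => ?_⟩
  set a : PointRequest := (g, 0, 0, ⟨∅, MeasurableSet.empty⟩) with ha
  refine ⟨Set.range fun i => PointRequest.point i a (z (Sum.inl a)), ?_, Set.finite_range _,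
    Set.range_nonempty _, Filter.Eventually.of_forall fun n => ?_⟩
  · rintro _ ⟨i, rfl⟩
    cases i
    · exact Or.inl ⟨a, rfl⟩
    · exact Or.inr ⟨a, rfl⟩
  · obtain ⟨i, hi⟩ := exists_le_parityPoint_zero g 0 (z (Sum.inl a)) n
    exact ⟨_, ⟨i, rfl⟩, hi⟩
end

section
/- Let X ⊆ ℝ (with the subspace topology). The following are equivalent: (1) X satisfies S1(Ω,Ω); (2) X satisfies Ω → (Ω)²₂; (3) for all n ≥ 1 and k ≥ 1, X satisfies Ω → (Ω)ⁿ_k. -/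
open Filter Set

/-- The partition property `Ω → (Ω)ⁿ_k`: for every open `ω`-cover `𝒰` and every coloring
of the `n`-element subsets of `𝒰` with `k` colors, some subfamily of `𝒰` which is an
`ω`-cover has all of its `n`-element subsets of one color. -/
def OmegaRamseyOmega (X : Type*) [TopologicalSpace X] (n k : ℕ) : Prop :=
  ∀ 𝒰 : Set (Set X), IsOpenOmegaCover 𝒰 →
    ∀ c : Finset (Set X) → Fin k,
      ∃ (j : Fin k) (𝒱 : Set (Set X)), 𝒱 ⊆ 𝒰 ∧ IsOmegaCover 𝒱 ∧
        ∀ s : Finset (Set X), ↑s ⊆ 𝒱 → s.card = n → c s = j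

theorem isOmegaCover_iff {Y : Type*} {𝒰 : Set (Set Y)} :
    IsOmegaCover 𝒰 ↔ (∀ U ∈ 𝒰, U ≠ univ) ∧ ∀ F : Set Y, F.Finite → ∃ U ∈ 𝒰, F ⊆ U := by
  refine ⟨fun h => h.2, fun h => ⟨eq_univ_of_forall fun x => ?_, h⟩⟩
  obtain ⟨U, hU, hx⟩ := h.2 {x} (finite_singleton x)
  exact ⟨U, hU, hx rfl⟩

theorem IsOmegaCover.nonempty {Y : Type*} {𝒰 : Set (Set Y)} (h : IsOmegaCover 𝒰) :
    𝒰.Nonempty := by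
  obtain ⟨U, hU, -⟩ := h.2.2 ∅ finite_empty
  exact ⟨U, hU⟩

theorem IsOmegaCover.infinite {Y : Type*} {𝒰 : Set (Set Y)} (h : IsOmegaCover 𝒰) :
    𝒰.Infinite := by
  intro hfin
  have hx : ∀ U : Set Y, ∃ x : Set Y, x.Finite ∧ (U ∈ 𝒰 → ¬ x ⊆ U) := by
    intro U
    by_cases hU : U ∈ 𝒰
    · obtain ⟨y, hy⟩ := (ne_univ_iff_exists_notMem U).1 (h.2.1 U hU)
      exact ⟨{y}, finite_singleton y, fun _ hs => hy (hs rfl)⟩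
    · exact ⟨∅, finite_empty, fun hU' => absurd hU' hU⟩
  choose x hxf hx using hx
  obtain ⟨U, hU, hs⟩ := h.2.2 (⋃ U ∈ 𝒰, x U) (hfin.biUnion fun U _ => hxf U)
  exact hx U hU ((subset_biUnion_of_mem (u := x) hU).trans hs)

/-- In a second countable space every open `ω`-cover has a countable `ω`-subcover. -/
theorem IsOpenOmegaCover.exists_countable_subcover {Y : Type*} [TopologicalSpace Y]
    [SecondCountableTopology Y] {𝒰 : Set (Set Y)} (h : IsOpenOmegaCover 𝒰) :
    ∃ 𝒱 ⊆ 𝒰, 𝒱.Countable ∧ IsOmegaCover 𝒱 := by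
  classical
  set b := TopologicalSpace.countableBasis Y
  have hbasis := TopologicalSpace.isBasis_countableBasis Y
  obtain ⟨U₀, hU₀⟩ := h.2.nonempty
  have hsel : ∀ s : Set (Set Y), ∃ U ∈ 𝒰, (∃ U' ∈ 𝒰, ⋃₀ s ⊆ U') → ⋃₀ s ⊆ U := by
    intro s
    by_cases hs : ∃ U' ∈ 𝒰, ⋃₀ s ⊆ U'
    · obtain ⟨U, hU, hsU⟩ := hs
      exact ⟨U, hU, fun _ => hsU⟩
    · exact ⟨U₀, hU₀, fun h' => absurd h' hs⟩
  choose sel hsel𝒰 hsel using hsel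
  have hsub : sel '' {s | s.Finite ∧ s ⊆ b} ⊆ 𝒰 := by
    rintro _ ⟨s, -, rfl⟩
    exact hsel𝒰 s
  refine ⟨_, hsub, (countable_ofPred_finite_subset
    (TopologicalSpace.countable_countableBasis Y)).image sel,
    isOmegaCover_iff.2 ⟨fun U hU => h.2.2.1 U (hsub hU), fun F hF => ?_⟩⟩
  obtain ⟨U, hU, hFU⟩ := h.2.2.2 F hF
  have hB : ∀ x : Y, ∃ B : Set Y, x ∈ F → B ∈ b ∧ x ∈ B ∧ B ⊆ U := by
    intro x
    by_cases hx : x ∈ F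
    · obtain ⟨B, hB, hxB, hBU⟩ := hbasis.exists_subset_of_mem_open (hFU hx) (h.1 U hU)
      exact ⟨B, fun _ => ⟨hB, hxB, hBU⟩⟩
    · exact ⟨∅, fun h' => absurd h' hx⟩
  choose B hB using hB
  refine ⟨sel (B '' F), ⟨B '' F, ⟨hF.image B, ?_⟩, rfl⟩, ?_⟩
  · rintro _ ⟨x, hx, rfl⟩
    exact (hB x hx).1
  · have hFB : F ⊆ ⋃₀ (B '' F) := fun x hx => ⟨B x, ⟨x, hx, rfl⟩, (hB x hx).2.1⟩
    refine hFB.trans (hsel _ ⟨U, hU, ?_⟩)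
    rintro y ⟨_, ⟨x, hx, rfl⟩, hy⟩
    exact (hB x hx).2.2 hy

theorem IsOpenOmegaCover.exists_injective_enumeration {Y : Type*} [TopologicalSpace Y]
    [SecondCountableTopology Y] {𝒰 : Set (Set Y)} (h : IsOpenOmegaCover 𝒰) :
    ∃ U : ℕ → Set Y, Function.Injective U ∧ (∀ n, U n ∈ 𝒰) ∧ IsOmegaCover (range U) := by
  obtain ⟨𝒱, h𝒱, hc, hω⟩ := h.exists_countable_subcover
  have := hc.to_subtype
  have := hω.infinite.to_subtype
  obtain ⟨e⟩ := nonempty_equiv_of_countable (α := ℕ) (β := 𝒱)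
  refine ⟨fun n => e n, Subtype.val_injective.comp e.injective, fun n => h𝒱 (e n).2, ?_⟩
  have : range (fun n => (e n : Set Y)) = 𝒱 := by
    rw [show (fun n => (e n : Set Y)) = Subtype.val ∘ e from rfl, e.surjective.range_comp,
      Subtype.range_coe]
  rwa [this]

theorem OmegaRamseyOmega.s1OmegaOmega {Y : Type*} [TopologicalSpace Y]
    [SecondCountableTopology Y] (h : OmegaRamseyOmega Y 2 2) : S1OmegaOmega Y := by
  classical
  intro 𝒰 h𝒰
  obtain ⟨B, -, hB𝒰, hB⟩ := (h𝒰 0).exists_injective_enumeration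
  have hBne : ∀ n, B n ≠ univ := fun n => hB.2.1 _ (mem_range_self n)
  set 𝒱 : Set (Set Y) := {W | ∃ n, ∃ U ∈ 𝒰 n, W = B n ∩ U}
  have h𝒱ω : IsOpenOmegaCover 𝒱 := by
    refine ⟨?_, isOmegaCover_iff.2 ⟨?_, fun F hF => ?_⟩⟩
    · rintro _ ⟨n, U, hU, rfl⟩
      exact ((h𝒰 0).1 _ (hB𝒰 n)).inter ((h𝒰 n).1 U hU)
    · rintro _ ⟨n, U, hU, rfl⟩ heq
      exact hBne n (univ_subset_iff.1 (heq ▸ inter_subset_left))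
    · obtain ⟨_, ⟨n, rfl⟩, hn⟩ := hB.2.2 F hF
      obtain ⟨U, hU, hFU⟩ := (h𝒰 n).2.2.2 F hF
      exact ⟨_, ⟨n, U, hU, rfl⟩, subset_inter hn hFU⟩
  have hrep : ∀ W : Set Y, ∃ (n : ℕ) (U : Set Y), W ∈ 𝒱 → U ∈ 𝒰 n ∧ W = B n ∩ U := by
    intro W
    by_cases hW : W ∈ 𝒱
    · obtain ⟨n, U, hU, hWU⟩ := hW
      exact ⟨n, U, fun _ => ⟨hU, hWU⟩⟩
    · exact ⟨0, ∅, fun h' => absurd h' hW⟩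
  choose N T hNT using hrep
  obtain ⟨j, 𝒲, h𝒲, hω, hhom⟩ := h 𝒱 h𝒱ω fun s => if ∃ n, ∀ W ∈ s, N W = n then 0 else 1
  have hpair : ∀ W ∈ 𝒲, ∀ W' ∈ 𝒲, W ≠ W' →
      (if ∃ n, ∀ V ∈ ({W, W'} : Finset (Set Y)), N V = n then (0 : Fin 2) else 1) = j := by
    intro W hW W' hW' hne
    refine hhom {W, W'} ?_ (Finset.card_pair hne)
    simp [insert_subset_iff, hW, hW']
  by_cases hj : j = 0
  · obtain ⟨W₀, hW₀⟩ := hω.nonempty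
    obtain ⟨x, hx⟩ := (ne_univ_iff_exists_notMem _).1 (hBne (N W₀))
    obtain ⟨W, hW, hxW⟩ := hω.2.2 {x} (finite_singleton x)
    have hN : N W = N W₀ := by
      by_contra hne
      have := hpair W hW W₀ hW₀ (fun h' => hne (h' ▸ rfl))
      rw [hj, if_neg (by rintro ⟨n, hn⟩; exact hne (by rw [hn W (by simp), hn W₀ (by simp)]))]
        at this
      exact absurd this (by decide)
    have hxB : x ∈ B (N W) := ((hNT W (h𝒲 hW)).2 ▸ hxW rfl : x ∈ B (N W) ∩ T W).1
    exact absurd (hN ▸ hxB) hx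
  · have hinj : ∀ W ∈ 𝒲, ∀ W' ∈ 𝒲, N W = N W' → W = W' := by
      intro W hW W' hW' heq
      by_contra hne
      have := hpair W hW W' hW' hne
      rw [if_pos ⟨N W', by simp [heq]⟩] at this
      exact hj this.symm
    have hsel : ∀ n, ∃ U ∈ 𝒰 n, ∀ W ∈ 𝒲, N W = n → U = T W := by
      intro n
      by_cases hn : ∃ W ∈ 𝒲, N W = n
      · obtain ⟨W, hW, rfl⟩ := hn
        exact ⟨T W, (hNT W (h𝒲 hW)).1, fun W' hW' heq => by rw [hinj W' hW' W hW heq]⟩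
      · obtain ⟨U, hU⟩ := (h𝒰 n).2.nonempty
        exact ⟨U, hU, fun W hW hWn => absurd ⟨W, hW, hWn⟩ hn⟩
    choose U hU𝒰 hU using hsel
    refine ⟨U, hU𝒰, isOmegaCover_iff.2 ⟨?_, fun F hF => ?_⟩⟩
    · rintro _ ⟨n, rfl⟩
      exact (h𝒰 n).2.2.1 _ (hU𝒰 n)
    · obtain ⟨W, hW, hFW⟩ := hω.2.2 F hF
      refine ⟨_, mem_range_self (N W), ?_⟩
      rw [hU _ W hW rfl]
      rw [(hNT W (h𝒲 hW)).2] at hFW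
      exact hFW.trans inter_subset_right

theorem exists_nat_seq_mem_of_forall_initial {α : Type*} [Inhabited α] (S : ℕ → Set α)
    (r : α → α → Prop)
    (h : ∀ n (f : ℕ → α), (∀ i < n, f i ∈ S i) → ∃ s ∈ S n, ∀ i < n, r (f i) s) :
    ∃ f : ℕ → α, ∀ n, f n ∈ S n ∧ ∀ i < n, r (f i) (f n) := by
  classical
  let step : ∀ n, (∀ i, i < n → α) → α := fun n prev =>
    if H : ∃ s ∈ S n, ∀ i (hi : i < n), r (prev i hi) s then H.choose else default
  let f : ℕ → α := WellFounded.fix Nat.lt_wfRel.wf step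
  have hf : ∀ n, f n = step n fun i _ => f i := fun n => WellFounded.fix_eq _ _ _
  refine ⟨f, fun n => ?_⟩
  induction n using Nat.strong_induction_on with
  | _ n ih =>
    have H : ∃ s ∈ S n, ∀ i (_ : i < n), r (f i) s := h n f fun i hi => (ih i hi).1
    have hn : f n = H.choose := by
      rw [hf n]
      exact dif_pos H
    rw [hn]
    exact H.choose_spec

theorem Set.Infinite.exists_finset_card_eq_pairwise {α : Type*} {T : Set α} (hT : T.Infinite)
    (Q : α → α → Prop) (hQs : ∀ s t, Q s t → Q t s) (hQ : ∀ s ∈ T, {t ∈ T | Q s t}.Finite)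
    (n : ℕ) :
    ∃ S : Finset α, ↑S ⊆ T ∧ S.card = n ∧ ∀ s ∈ S, ∀ t ∈ S, s ≠ t → ¬ Q s t := by
  classical
  induction n with
  | zero => exact ⟨∅, by simp, rfl, by simp⟩
  | succ n ih =>
    obtain ⟨S, hST, hcard, hS⟩ := ih
    have hfin : (↑S ∪ ⋃ s ∈ (S : Set α), {t ∈ T | Q s t}).Finite :=
      S.finite_toSet.union (S.finite_toSet.biUnion fun s hs => hQ s (hST hs))
    obtain ⟨t, htT, ht⟩ := (hT.sdiff hfin).nonempty
    simp only [mem_union, mem_iUnion, mem_ofPred_eq, not_or, not_exists, not_and] at ht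
    have htS : t ∉ S := ht.1
    refine ⟨insert t S, ?_, by rw [Finset.card_insert_of_notMem htS, hcard], ?_⟩
    · rw [Finset.coe_insert]
      exact insert_subset htT hST
    · intro s hs u hu hne
      rw [Finset.mem_insert] at hs hu
      rcases hs with rfl | hs <;> rcases hu with rfl | hu
      · exact absurd rfl hne
      · exact fun h => ht.2 u hu htT (hQs _ _ h)
      · exact ht.2 s hs htT
      · exact hS s hs u hu hne

/-- If `S1(Ω,Ω)` holds and `R` is a locally finite graph on the indices of an open `ω`-cover,
then some `R`-independent set of indices still yields an `ω`-cover. -/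
theorem S1OmegaOmega.exists_independent_subcover {Y : Type*} [TopologicalSpace Y]
    (h : S1OmegaOmega Y) {U : ℕ → Set Y} (hUo : ∀ n, IsOpen (U n)) {B : Set ℕ}
    (hB : IsOmegaCover (U '' B)) (R : ℕ → ℕ → Prop) (hRs : ∀ s t, R s t → R t s)
    (hR : ∀ v ∈ B, {s ∈ B | R v s}.Finite) :
    ∃ C ⊆ B, IsOmegaCover (U '' C) ∧ ∀ s ∈ C, ∀ t ∈ C, s ≠ t → ¬ R s t := by
  classical
  have hne : ∀ m ∈ B, U m ≠ univ := fun m hm => hB.2.1 _ (mem_image_of_mem U hm)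
  have hinf : ∀ F : Set Y, F.Finite → {m ∈ B | F ⊆ U m}.Infinite := by
    intro F hF hfin
    refine IsOmegaCover.infinite (𝒰 := U '' {m ∈ B | F ⊆ U m})
      (isOmegaCover_iff.2 ⟨?_, fun G hG => ?_⟩) (hfin.image U)
    · rintro _ ⟨m, hm, rfl⟩
      exact hne m hm.1
    · obtain ⟨_, ⟨m, hm, rfl⟩, hFG⟩ := hB.2.2 (F ∪ G) (hF.union hG)
      exact ⟨_, ⟨m, ⟨hm, subset_union_left.trans hFG⟩, rfl⟩, subset_union_right.trans hFG⟩
  set Q : ℕ → ℕ → Prop := fun s t => ∃ v ∈ B, R v s ∧ R v t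
  have hQ : ∀ s ∈ B, {t ∈ B | Q s t}.Finite := by
    intro s hs
    refine ((hR s hs).biUnion fun v hv => hR v hv.1).subset ?_
    rintro t ⟨ht, v, hv, hvs, hvt⟩
    exact mem_biUnion (show v ∈ {v ∈ B | R s v} from ⟨hv, hRs _ _ hvs⟩) ⟨ht, hvt⟩
  have hcov : ∀ n, IsOpenOmegaCover {W | ∃ S : Finset ℕ, ↑S ⊆ B ∧ S.card = n + 1 ∧
      (∀ s ∈ S, ∀ t ∈ S, s ≠ t → ¬ Q s t) ∧ W = ⋂ s ∈ S, U s} := by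
    intro n
    refine ⟨?_, isOmegaCover_iff.2 ⟨?_, fun F hF => ?_⟩⟩
    · rintro _ ⟨S, -, -, -, rfl⟩
      exact isOpen_biInter_finset fun s _ => hUo s
    · rintro _ ⟨S, hSB, hcard, -, rfl⟩ heq
      obtain ⟨s, hs⟩ := Finset.card_pos.1 (by omega : 0 < S.card)
      exact hne s (hSB hs) (univ_subset_iff.1 (heq ▸ biInter_subset_of_mem hs))
    · obtain ⟨S, hST, hcard, hS⟩ := (hinf F hF).exists_finset_card_eq_pairwise Q
        (fun s t ⟨v, hv, h₁, h₂⟩ => ⟨v, hv, h₂, h₁⟩)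
        (fun s hs => (hQ s hs.1).subset fun t ht => ⟨ht.1.1, ht.2⟩) (n + 1)
      exact ⟨_, ⟨S, fun s hs => (hST hs).1, hcard, hS, rfl⟩,
        subset_iInter₂ fun s hs => (hST hs).2⟩
  obtain ⟨V, hV, hVω⟩ := h _ hcov
  choose S hSB hcard hS hVS using hV
  obtain ⟨m, hm⟩ := exists_nat_seq_mem_of_forall_initial (fun n => (S n : Set ℕ))
    (fun s t => ¬ R s t) (by
      intro n f hf
      by_contra! hbad
      choose! g hgn hg using hbad
      obtain ⟨s, hs, t, ht, hst, hgst⟩ := Finset.exists_ne_map_eq_of_card_lt_of_maps_to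
        (s := S n) (t := Finset.range n) (f := g) (by simp [hcard])
        (fun s hs => by simpa using hgn s hs)
      exact hS n s hs t ht hst
        ⟨f (g s), hSB _ (hf _ (hgn s hs)), hg s hs, hgst ▸ hg t ht⟩)
  have hmB : range m ⊆ B := by
    rintro _ ⟨n, rfl⟩
    exact hSB n (hm n).1
  refine ⟨range m, hmB, isOmegaCover_iff.2 ⟨?_, fun F hF => ?_⟩, ?_⟩
  · rintro _ ⟨k, hk, rfl⟩
    exact hne k (hmB hk)
  · obtain ⟨_, ⟨n, rfl⟩, hFV⟩ := hVω.2.2 F hF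
    refine ⟨_, mem_image_of_mem U (mem_range_self n), hFV.trans ?_⟩
    rw [hVS n]
    exact biInter_subset_of_mem (hm n).1
  · rintro _ ⟨i, rfl⟩ _ ⟨j, rfl⟩ hij
    rcases lt_trichotomy i j with hlt | rfl | hlt
    · exact (hm j).2 i hlt
    · exact absurd rfl hij
    · exact fun hr => (hm i).2 j hlt (hRs _ _ hr)

/-- Under `S1(Ω,Ω)`, decreasing sequences of `ω`-subcovers of an open `ω`-cover can be
diagonalized. -/
theorem S1OmegaOmega.exists_diagonal_subcover {Y : Type*} [TopologicalSpace Y]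
    (h : S1OmegaOmega Y) {U : ℕ → Set Y} (hUo : ∀ n, IsOpen (U n)) {D : ℕ → Set ℕ}
    (hD : Antitone D) (hDω : ∀ n, IsOmegaCover (U '' D n)) :
    ∃ C ⊆ D 0, IsOmegaCover (U '' C) ∧ ∀ i ∈ C, ∀ j ∈ C, i < j → j ∈ D i := by
  obtain ⟨V, hV, hVω⟩ := h (fun n => U '' D n) fun n =>
    ⟨by rintro _ ⟨m, -, rfl⟩; exact hUo m, hDω n⟩
  choose m hmD hmV using hV
  have hrange : U '' range m = range V := by
    rw [← range_comp]
    exact congrArg range (funext hmV)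
  have hfin : ∀ j, {k ∈ range m | k ∉ D j}.Finite := by
    intro j
    refine ((finite_Iio j).image m).subset ?_
    rintro _ ⟨⟨n, rfl⟩, hn⟩
    exact ⟨n, not_le.1 fun hjn => hn (hD hjn (hmD n)), rfl⟩
  obtain ⟨C, hC, hCω, hCR⟩ := h.exists_independent_subcover hUo (B := range m) (hrange ▸ hVω)
    (fun s t => (s < t ∧ t ∉ D s) ∨ (t < s ∧ s ∉ D t)) (fun s t => Or.symm) (by
      intro v _
      refine ((hfin v).union (finite_Iio v)).subset ?_
      rintro s ⟨hs, ⟨-, hsv⟩ | ⟨hsv, -⟩⟩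
      · exact Or.inl ⟨hs, hsv⟩
      · exact Or.inr hsv)
  refine ⟨C, fun c hc => ?_, hCω, fun i hi j hj hij => ?_⟩
  · obtain ⟨n, rfl⟩ := hC hc
    exact hD (Nat.zero_le n) (hmD n)
  · by_contra hjD
    exact hCR i hi j hj hij.ne (Or.inl ⟨hij, hjD⟩)

theorem IsOmegaCover.exists_fiber {Y : Type*} {U : ℕ → Set Y} {B : Set ℕ}
    (hB : IsOmegaCover (U '' B)) {k : ℕ} (f : ℕ → Fin k) :
    ∃ j, IsOmegaCover (U '' {i ∈ B | f i = j}) := by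
  by_contra! hno
  have hF : ∀ j, ∃ F : Set Y, F.Finite ∧ ∀ i ∈ B, f i = j → ¬ F ⊆ U i := by
    intro j
    by_contra! hj
    refine hno j (isOmegaCover_iff.2 ⟨?_, fun F hF => ?_⟩)
    · rintro _ ⟨i, hi, rfl⟩
      exact hB.2.1 _ (mem_image_of_mem U hi.1)
    · obtain ⟨i, hi, hij, hFi⟩ := hj F hF
      exact ⟨_, ⟨i, ⟨hi, hij⟩, rfl⟩, hFi⟩
  choose F hFf hF using hF
  obtain ⟨_, ⟨i, hi, rfl⟩, hs⟩ := hB.2.2 (⋃ j, F j) (finite_iUnion hFf)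
  exact hF (f i) i hi rfl ((subset_iUnion F (f i)).trans hs)

theorem S1OmegaOmega.exists_homogeneous_subcover {Y : Type*} [TopologicalSpace Y]
    (h : S1OmegaOmega Y) {U : ℕ → Set Y} (hUo : ∀ n, IsOpen (U n)) {k : ℕ} (n : ℕ) :
    ∀ (c : Finset ℕ → Fin k) (A : Set ℕ), IsOmegaCover (U '' A) →
      ∃ B ⊆ A, IsOmegaCover (U '' B) ∧
        ∃ j, ∀ s : Finset ℕ, ↑s ⊆ B → s.card = n → c s = j := by
  classical
  induction n with
  | zero =>
    intro c A hA
    exact ⟨A, Subset.rfl, hA, c ∅, fun s _ hs => by rw [Finset.card_eq_zero.1 hs]⟩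
  | succ n ih =>
    intro c A hA
    choose next hsub hω col hcol using fun (i : ℕ) (A : {A : Set ℕ // IsOmegaCover (U '' A)}) =>
      ih (fun s => c (insert i s)) A.1 A.2
    let E : ℕ → {A : Set ℕ // IsOmegaCover (U '' A)} :=
      fun i => Nat.rec ⟨A, hA⟩ (fun i A => ⟨next i A, hω i A⟩) i
    have hE : ∀ i, (E (i + 1)).1 = next i (E i) := fun i => rfl
    have hanti : Antitone fun i => (E (i + 1)).1 := antitone_nat_of_succ_le fun i => hsub _ _
    obtain ⟨B, hB0, hBω, hB⟩ := h.exists_diagonal_subcover hUo hanti fun i => (E (i + 1)).2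
    obtain ⟨j, hj⟩ := hBω.exists_fiber fun i => col i (E i)
    refine ⟨_, fun i hi => hsub 0 _ (hB0 hi.1), hj, j, fun s hs hcard => ?_⟩
    have hsne : s.Nonempty := Finset.card_pos.1 (by omega)
    have hmin := s.min'_mem hsne
    set i := s.min' hsne
    rw [← (hs hmin).2, ← hcol i (E i) (s.erase i) (fun t ht => ?_)
      (by rw [Finset.card_erase_of_mem hmin, hcard]; rfl), Finset.insert_erase hmin]
    have hts := Finset.mem_of_mem_erase (Finset.mem_coe.1 ht)
    exact hB i (hs hmin).1 t (hs hts).1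
      (lt_of_le_of_ne (s.min'_le t hts) (Finset.ne_of_mem_erase ht).symm)

theorem S1OmegaOmega.omegaRamseyOmega {Y : Type*} [TopologicalSpace Y]
    [SecondCountableTopology Y] (h : S1OmegaOmega Y) (n k : ℕ) : OmegaRamseyOmega Y n k := by
  classical
  intro 𝒰 h𝒰 c
  obtain ⟨U, hinj, hU𝒰, hU⟩ := h𝒰.exists_injective_enumeration
  obtain ⟨B, -, hB, j, hj⟩ := h.exists_homogeneous_subcover (fun m => h𝒰.1 _ (hU𝒰 m)) n
    (fun s => c (s.image U)) univ (by rwa [image_univ])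
  refine ⟨j, U '' B, ?_, hB, fun s hs hcard => ?_⟩
  · rintro _ ⟨m, -, rfl⟩
    exact hU𝒰 m
  · obtain ⟨t, htB, rfl⟩ := Finset.subset_set_image_iff.1 hs
    exact hj t htB (by rwa [Finset.card_image_of_injective t hinj] at hcard)

/-- Just–Miller–Scheepers–Szeptycki: for a set of reals, `S1(Ω,Ω)`, `Ω → (Ω)²₂`, and
`Ω → (Ω)ⁿ_k` for all `n, k ≥ 1` are equivalent. -/
theorem s1OmegaOmega_ramsey_characterization (X : Set ℝ) :
    (S1OmegaOmega X ↔ OmegaRamseyOmega X 2 2) ∧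
    (S1OmegaOmega X ↔ ∀ n k : ℕ, 1 ≤ n → 1 ≤ k → OmegaRamseyOmega X n k) :=
  ⟨⟨fun h => h.omegaRamseyOmega 2 2, fun h => h.s1OmegaOmega⟩,
    ⟨fun h n k _ _ => h.omegaRamseyOmega n k,
      fun h => (h 2 2 one_le_two one_le_two).s1OmegaOmega⟩⟩
end

section
/- The Cantor space 2^ℕ satisfies (Τ choose Γ): every open τ-cover 𝒰 of 2^ℕ contains a subfamily 𝒱 ⊆ 𝒰 which is a γ-cover of 2^ℕ. -/
open Filter Set

/-- A large cover: every point belongs to infinitely many members. -/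
def IsLargeCover {X : Type*} (𝒰 : Set (Set X)) : Prop :=
  ⋃₀ 𝒰 = Set.univ ∧ ∀ x : X, {U ∈ 𝒰 | x ∈ U}.Infinite

/-- A `τ`-cover: a large cover such that for all points `x, y`, one of the sets of members
separating `x` from `y` (or `y` from `x`) is finite. -/
def IsTauCover {X : Type*} (𝒰 : Set (Set X)) : Prop :=
  IsLargeCover 𝒰 ∧ ∀ x y : X,
    {U ∈ 𝒰 | x ∈ U ∧ y ∉ U}.Finite ∨ {U ∈ 𝒰 | y ∈ U ∧ x ∉ U}.Finite

open TopologicalSpace Topology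

/-- Every relation on a Polish space which is total and a countable union of closed sets has a
countable coinitial set. -/
theorem exists_countable_coinitial_of_isClosed
    {X ι : Type*} [TopologicalSpace X] [PolishSpace X] [Countable ι]
    (L : ι → Set (X × X)) (hL : ∀ i, IsClosed (L i))
    (htotal : ∀ x y, (∃ i, (x, y) ∈ L i) ∨ ∃ i, (y, x) ∈ L i) :
    ∃ S : Set X, S.Countable ∧ ∀ y, ∃ s ∈ S, ∃ i, (s, y) ∈ L i := by
  let 𝒟 : Set (Set X) :=
    {D | IsOpen D ∧ ∃ S : Set X, S.Countable ∧ ∀ y ∈ D, ∃ s ∈ S, ∃ i, (s, y) ∈ L i}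
  obtain ⟨T, hTc, hTsub, hTeq⟩ := isOpen_sUnion_countable 𝒟 fun D hD => hD.1
  choose! σ hσc hσ using fun D (hD : D ∈ 𝒟) => hD.2
  have hS : (⋃ D ∈ T, σ D).Countable := hTc.biUnion fun D hD => hσc D (hTsub hD)
  have hWS : ∀ y ∈ ⋃₀ 𝒟, ∃ s ∈ ⋃ D ∈ T, σ D, ∃ i, (s, y) ∈ L i := by
    intro y hy
    rw [← hTeq] at hy
    obtain ⟨D, hD, hyD⟩ := hy
    obtain ⟨s, hs, hsy⟩ := hσ D (hTsub hD) y hyD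
    exact ⟨s, mem_biUnion hD hs, hsy⟩
  have key : ∀ C D : Set X, IsOpen D → (C ∩ (⋃₀ 𝒟)ᶜ).Nonempty → (D ∩ (⋃₀ 𝒟)ᶜ).Nonempty →
      ∀ i, (∀ x ∈ C ∩ (⋃₀ 𝒟)ᶜ, ∀ y ∈ D ∩ (⋃₀ 𝒟)ᶜ, (x, y) ∈ L i) → False := by
    rintro C D hD ⟨x, hx⟩ ⟨d, hdD, hd⟩ i h
    refine hd ⟨D, ⟨hD, insert x (⋃ D ∈ T, σ D), hS.insert x, fun y hy => ?_⟩, hdD⟩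
    by_cases hyW : y ∈ ⋃₀ 𝒟
    · obtain ⟨s, hs, hsy⟩ := hWS y hyW
      exact ⟨s, mem_insert_of_mem _ hs, hsy⟩
    · exact ⟨x, mem_insert _ _, i, h x hx y ⟨hy, hyW⟩⟩
  refine ⟨_, hS, fun y => hWS y ?_⟩
  by_contra hy
  have hK : IsClosed (⋃₀ 𝒟)ᶜ := (isOpen_sUnion fun D hD => hD.1).isClosed_compl
  have := hK.polishSpace
  have : Nonempty ↥(⋃₀ 𝒟)ᶜ := ⟨⟨y, hy⟩⟩
  let M : ι ⊕ ι → Set (((⋃₀ 𝒟)ᶜ : Set X) × ((⋃₀ 𝒟)ᶜ : Set X)) := Sum.elim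
    (fun i => {p | ((p.1 : X), (p.2 : X)) ∈ L i}) (fun i => {p | ((p.2 : X), (p.1 : X)) ∈ L i})
  have hM : ∀ j, IsClosed (M j) := by
    rintro (i | i)
    · exact (hL i).preimage
        (f := fun p : ((⋃₀ 𝒟)ᶜ : Set X) × ((⋃₀ 𝒟)ᶜ : Set X) => ((p.1 : X), (p.2 : X))) (by fun_prop)
    · exact (hL i).preimage
        (f := fun p : ((⋃₀ 𝒟)ᶜ : Set X) × ((⋃₀ 𝒟)ᶜ : Set X) => ((p.2 : X), (p.1 : X))) (by fun_prop)
  have hMU : ⋃ j, M j = univ := by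
    refine eq_univ_of_forall fun p => mem_iUnion.2 ?_
    rcases htotal p.1 p.2 with ⟨i, hi⟩ | ⟨i, hi⟩
    · exact ⟨Sum.inl i, hi⟩
    · exact ⟨Sum.inr i, hi⟩
  obtain ⟨j, ⟨a, b⟩, hab⟩ := nonempty_interior_of_iUnion_of_closed hM hMU
  rw [mem_interior_iff_mem_nhds, mem_nhds_prod_iff'] at hab
  obtain ⟨_, _, hu, hau, hv, hbv, huv⟩ := hab
  obtain ⟨C, hC, rfl⟩ := isOpen_induced_iff.1 hu
  obtain ⟨D, hD, rfl⟩ := isOpen_induced_iff.1 hv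
  rcases j with i | i
  · exact key C D hD ⟨a, hau, a.2⟩ ⟨b, hbv, b.2⟩ i fun x hx y hy =>
      @huv (⟨x, hx.2⟩, ⟨y, hy.2⟩) ⟨hx.1, hy.1⟩
  · exact key D C hC ⟨b, hbv, b.2⟩ ⟨a, hau, a.2⟩ i fun x hx y hy =>
      @huv (⟨y, hy.2⟩, ⟨x, hx.2⟩) ⟨hy.1, hx.1⟩

/-- In a second countable space, every large open cover contains a countable large cover. -/
theorem IsLargeCover.exists_countable_subset {X : Type*} [TopologicalSpace X]
    [SecondCountableTopology X] {𝒰 : Set (Set X)} (hopen : ∀ U ∈ 𝒰, IsOpen U)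
    (h : IsLargeCover 𝒰) : ∃ 𝒱 ⊆ 𝒰, 𝒱.Countable ∧ IsLargeCover 𝒱 := by
  have hfin : ∀ k : ℕ, ∃ T : Set {G : Finset (Set X) // ↑G ⊆ 𝒰 ∧ G.card = k}, T.Countable ∧
      ∀ x, ∃ G ∈ T, ∀ U ∈ G.1, x ∈ U := by
    intro k
    obtain ⟨T, hT, hTeq⟩ := isOpen_iUnion_countable
      (fun G : {G : Finset (Set X) // ↑G ⊆ 𝒰 ∧ G.card = k} => ⋂ U ∈ G.1, U)
      (fun G => isOpen_biInter_finset fun U hU => hopen U (G.2.1 hU))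
    refine ⟨T, hT, fun x => ?_⟩
    obtain ⟨G, hG, hGk⟩ := (h.2 x).exists_subset_card_eq k
    have hx : x ∈ ⋃ G : {G : Finset (Set X) // ↑G ⊆ 𝒰 ∧ G.card = k}, ⋂ U ∈ G.1, U :=
      mem_iUnion.2 ⟨⟨G, fun U hU => (hG hU).1, hGk⟩, mem_iInter₂.2 fun U hU => (hG hU).2⟩
    rw [← hTeq] at hx
    simpa using hx
  choose T hTc hT using hfin
  let 𝒱 : Set (Set X) := ⋃ k, ⋃ G ∈ T k, (G.1 : Set (Set X))
  have hlarge : ∀ x, {U ∈ 𝒱 | x ∈ U}.Infinite := by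
    intro x hx
    obtain ⟨G, hG, hGx⟩ := hT (hx.toFinset.card + 1) x
    have hsub : G.1 ⊆ hx.toFinset := fun U hU =>
      hx.mem_toFinset.2 ⟨mem_iUnion.2 ⟨_, mem_biUnion hG hU⟩, hGx U hU⟩
    have := Finset.card_le_card hsub
    rw [G.2.2] at this
    omega
  refine ⟨𝒱, iUnion_subset fun k => iUnion₂_subset fun G _ => G.2.1,
    countable_iUnion fun k => (hTc k).biUnion fun G _ => G.1.countable_toSet, ?_, hlarge⟩
  refine eq_univ_of_forall fun x => ?_
  obtain ⟨U, hU, hxU⟩ := (hlarge x).nonempty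
  exact ⟨U, hU, hxU⟩

theorem IsTauCover.mono_of_isLargeCover {X : Type*} {𝒰 𝒱 : Set (Set X)} (h : IsTauCover 𝒰)
    (hsub : 𝒱 ⊆ 𝒰) (hlarge : IsLargeCover 𝒱) : IsTauCover 𝒱 :=
  ⟨hlarge, fun x y => (h.2 x y).imp (fun hf => hf.subset fun _ hU => ⟨hsub hU.1, hU.2⟩)
    fun hf => hf.subset fun _ hU => ⟨hsub hU.1, hU.2⟩⟩

/-- A countable open `τ`-cover of a Polish space admits a countable set of points which is
coinitial for the relation of being contained in fewer members modulo finite sets. -/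
theorem IsTauCover.exists_countable_coinitial {X : Type*} [TopologicalSpace X] [PolishSpace X]
    {𝒰 : Set (Set X)} (hopen : ∀ U ∈ 𝒰, IsOpen U) (hc : 𝒰.Countable) (h : IsTauCover 𝒰) :
    ∃ S : Set X, S.Countable ∧ ∀ y, ∃ s ∈ S, {U ∈ 𝒰 | s ∈ U ∧ y ∉ U}.Finite := by
  have := hc.to_subtype
  borelize X
  have hclopen (U : 𝒰) : PolishSpace.IsClopenable U.1 := (hopen U U.2).isClopenable
  choose τ hτle hτ hτclosed hτopen using hclopen
  obtain ⟨t, ht, -, htP⟩ := PolishSpace.exists_polishSpace_forall_le τ hτle hτ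
  have hclosed_t : ∀ U ∈ 𝒰, IsClosed[t] U := fun U hU => (hτclosed ⟨U, hU⟩).mono (ht _)
  have hopen_t : ∀ U ∈ 𝒰, IsOpen[t] U := fun U hU => (hτopen ⟨U, hU⟩).mono (ht _)
  have hL : ∀ x y,
      (∃ E : Finset 𝒰, (x, y) ∈ {p : X × X | ∀ U : 𝒰, U ∉ E → p.1 ∈ U.1 → p.2 ∈ U.1}) ↔
      {U ∈ 𝒰 | x ∈ U ∧ y ∉ U}.Finite := by
    intro x y
    constructor
    · rintro ⟨E, hE⟩
      refine (E.finite_toSet.image Subtype.val).subset ?_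
      rintro U ⟨hU, hx, hy⟩
      by_contra hUE
      exact hy (hE ⟨U, hU⟩ (fun hmem => hUE ⟨_, hmem, rfl⟩) hx)
    · intro hf
      have hf' : {U : 𝒰 | x ∈ U.1 ∧ y ∉ U.1}.Finite :=
        (hf.preimage Subtype.val_injective.injOn).subset fun U hU => ⟨U.2, hU⟩
      refine ⟨hf'.toFinset, fun U hU hx => ?_⟩
      by_contra hy
      exact hU (hf'.mem_toFinset.2 ⟨hx, hy⟩)
  obtain ⟨S, hS, hSy⟩ := @exists_countable_coinitial_of_isClosed X (Finset 𝒰) t htP _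
    (fun E => {p | ∀ U : 𝒰, U ∉ E → p.1 ∈ U.1 → p.2 ∈ U.1})
    (fun E => by
      let := t
      simp only [ofPred_forall]
      refine isClosed_iInter fun U => isClosed_iInter fun _ => ?_
      have h₁ : IsOpen {p : X × X | p.1 ∈ U.1} := (hopen_t U U.2).preimage continuous_fst
      have h₂ : IsClosed {p : X × X | p.2 ∈ U.1} := (hclosed_t U U.2).preimage continuous_snd
      exact isClosed_imp h₁ h₂)
    (fun x y => by rw [hL, hL]; exact h.2 x y)
  refine ⟨S, hS, fun y => ?_⟩
  obtain ⟨s, hs, hsy⟩ := hSy y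
  exact ⟨s, hs, (hL s y).1 hsy⟩

/-- Finitely many points lie in infinitely many common members of a `τ`-cover. -/
theorem IsTauCover.infinite_forall_le_mem {X : Type*} {𝒰 : Set (Set X)} (h : IsTauCover 𝒰)
    (s : ℕ → X) (k : ℕ) : {U ∈ 𝒰 | ∀ i ≤ k, s i ∈ U}.Infinite := by
  obtain ⟨x, hx⟩ : ∃ x, {U ∈ 𝒰 | x ∈ U ∧ ∃ i ≤ k, s i ∉ U}.Finite := by
    induction k with
    | zero => exact ⟨s 0, by simp +contextual⟩
    | succ k ih =>
      obtain ⟨x, hx⟩ := ih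
      rcases h.2 x (s (k + 1)) with hf | hf
      · refine ⟨x, (hx.union hf).subset ?_⟩
        rintro U ⟨hU, hxU, i, hi, hiU⟩
        rcases Nat.le_succ_iff.1 hi with hi | rfl
        · exact Or.inl ⟨hU, hxU, i, hi, hiU⟩
        · exact Or.inr ⟨hU, hxU, hiU⟩
      · refine ⟨s (k + 1), (hx.union hf).subset ?_⟩
        rintro U ⟨hU, hsU, i, hi, hiU⟩
        by_cases hxU : x ∈ U
        · rcases Nat.le_succ_iff.1 hi with hi | rfl
          · exact Or.inl ⟨hU, hxU, i, hi, hiU⟩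
          · exact absurd hsU hiU
        · exact Or.inr ⟨hU, hsU, hxU⟩
  refine ((h.1.2 x).sdiff hx).mono ?_
  rintro U ⟨⟨hU, hxU⟩, hn⟩
  refine ⟨hU, fun i hi => ?_⟩
  by_contra hiU
  exact hn ⟨hU, hxU, i, hi, hiU⟩

/-- A `τ`-cover with a countable coinitial set of points contains a `γ`-cover. -/
theorem IsTauCover.exists_isGammaCover_of_coinitial {X : Type*} {𝒰 : Set (Set X)}
    (h : IsTauCover 𝒰) (s : ℕ → X) (hs : ∀ y, ∃ i, {U ∈ 𝒰 | s i ∈ U ∧ y ∉ U}.Finite) :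
    ∃ 𝒱 ⊆ 𝒰, IsGammaCover 𝒱 := by
  obtain ⟨f, hf, hlt⟩ := exists_seq_of_forall_finset_exists
    (fun p : ℕ × Set X => p.2 ∈ 𝒰 ∧ ∀ i ≤ p.1, s i ∈ p.2)
    (fun p q => p.1 < q.1 ∧ p.2 ≠ q.2) (by
      classical
      intro E _
      obtain ⟨U, hU, hUE⟩ :=
        (h.infinite_forall_le_mem s (E.sup Prod.fst + 1)).exists_notMem_finset (E.image Prod.snd)
      refine ⟨(E.sup Prod.fst + 1, U), hU, fun p hp => ⟨?_, ?_⟩⟩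
      · exact Nat.lt_succ_of_le (Finset.le_sup (f := Prod.fst) hp)
      · rintro rfl
        exact hUE (Finset.mem_image_of_mem _ hp))
  have hmono : StrictMono fun n => (f n).1 := fun m n hmn => (hlt m n hmn).1
  have hinj : Function.Injective fun n => (f n).2 := by
    intro m n hmn
    rcases lt_trichotomy m n with hlt' | heq | hlt'
    · exact absurd hmn (hlt m n hlt').2
    · exact heq
    · exact absurd hmn.symm (hlt n m hlt').2
  have hinf : (range fun n => (f n).2).Infinite := infinite_range_of_injective hinj
  have hγ : ∀ x, {U ∈ range fun n => (f n).2 | x ∉ U}.Finite := by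
    intro x
    obtain ⟨i, hi⟩ := hs x
    refine (hi.union ((finite_lt_nat i).image fun n => (f n).2)).subset ?_
    rintro _ ⟨⟨n, rfl⟩, hx⟩
    rcases lt_or_ge n i with hn | hn
    · exact Or.inr ⟨n, hn, rfl⟩
    · exact Or.inl ⟨(hf n).1, (hf n).2 i (hn.trans (hmono.id_le n)), hx⟩
  refine ⟨range fun n => (f n).2, range_subset_iff.2 fun n => (hf n).1, hinf,
    eq_univ_of_forall fun x => ?_, hγ⟩
  obtain ⟨U, hU, hxU⟩ := (hinf.sdiff (hγ x)).nonempty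
  exact ⟨U, hU, by_contra fun hx => hxU ⟨hU, hx⟩⟩

/-- Shelah et al.: the Cantor space `2^ℕ` satisfies `(Τ choose Γ)`: every open `τ`-cover
contains a `γ`-cover. -/
theorem cantor_tau_choose_gamma (𝒰 : Set (Set (ℕ → Bool)))
    (hopen : ∀ U ∈ 𝒰, IsOpen U) (htau : IsTauCover 𝒰) :
    ∃ 𝒱 ⊆ 𝒰, IsGammaCover 𝒱 := by
  obtain ⟨𝒲, hsub, hc, hlarge⟩ := htau.1.exists_countable_subset hopen
  have h𝒲 := htau.mono_of_isLargeCover hsub hlarge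
  have : PolishSpace Bool :=
    ((continuous_of_discreteTopology (f := Bool.toNat)).isClosedEmbedding
      (by decide : Function.Injective Bool.toNat)).polishSpace
  obtain ⟨S, hS, hSy⟩ := h𝒲.exists_countable_coinitial (fun U hU => hopen U (hsub hU)) hc
  obtain ⟨s₀, hs₀, -⟩ := hSy fun _ => false
  obtain ⟨s, rfl⟩ := hS.exists_eq_range ⟨s₀, hs₀⟩
  obtain ⟨𝒱, h𝒱, hγ⟩ := h𝒲.exists_isGammaCover_of_coinitial s fun y => by simpa using hSy y
  exact ⟨𝒱, h𝒱.trans hsub, hγ⟩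
end
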